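/- arXiv:1005.4583 — 2 statements merged into one kernel-verified Lean document; each statement's English description precedes it below -/
import Mathlib

section
/- For every integer n ≥ 1, the following holds in ℤ[p,q]: Σ_{σ∈S_n} (−1)^{wex σ} p^{nest σ} q^{cros σ} = 0 if n is even, and Σ_{σ∈S_n} (−1)^{wex σ} p^{nest σ} q^{cros σ} = (−1)^{(n+1)/2} · Σ_{σ∈S_{n,(n−1)/2}} p^{res σ} q^{les σ} if n is odd. -/
open scoped Classical
open Finset

noncomputable section

namespace SZpaper

/-- `σ` as a 1-indexed function on `[1,n]`, extended by `0` elsewhere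
(boundary convention `σ(0)=σ(n+1)=0`). -/
def pext (n : ℕ) (σ : Equiv.Perm (Fin n)) (i : ℕ) : ℕ :=
  if h : 1 ≤ i ∧ i ≤ n then ((σ ⟨i - 1, by omega⟩ : Fin n) : ℕ) + 1 else 0

/-- `σ` extended with the Brändén boundary convention `σ(0)=σ(n+1)=n+1`. -/
def pextB (n : ℕ) (σ : Equiv.Perm (Fin n)) (i : ℕ) : ℕ :=
  if h : 1 ≤ i ∧ i ≤ n then ((σ ⟨i - 1, by omega⟩ : Fin n) : ℕ) + 1 else n + 1

/-- `σ` extended with the boundary convention `σ(0)=0`, `σ(n+1)=n+1`. -/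
def pextC (n : ℕ) (σ : Equiv.Perm (Fin n)) (i : ℕ) : ℕ :=
  if h : 1 ≤ i ∧ i ≤ n then ((σ ⟨i - 1, by omega⟩ : Fin n) : ℕ) + 1
  else if i = 0 then 0 else n + 1

/-- The set of pairs `(i,j)` with `i, j ∈ [1,n]`. -/
def pairs (n : ℕ) : Finset (ℕ × ℕ) := Finset.Icc 1 n ×ˢ Finset.Icc 1 n

/-- `des σ = #{i ∈ [n−1] : σ(i) > σ(i+1)}`. -/
def desStat (n : ℕ) (σ : Equiv.Perm (Fin n)) : ℕ :=
  ((Finset.Icc 1 (n - 1)).filter fun i => pext n σ (i + 1) < pext n σ i).card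

/-- `les σ = #{(i,j) : 2 ≤ i < j ≤ n, σ(i−1) > σ(j) > σ(i)}`. -/
def lesStat (n : ℕ) (σ : Equiv.Perm (Fin n)) : ℕ :=
  ((pairs n).filter fun x => 2 ≤ x.1 ∧ x.1 < x.2 ∧
    pext n σ x.1 < pext n σ x.2 ∧ pext n σ x.2 < pext n σ (x.1 - 1)).card

/-- `less σ = #{(i,j) : 2 ≤ i < j ≤ n, σ(i−1) < σ(j) < σ(i)}`. -/
def lessStat (n : ℕ) (σ : Equiv.Perm (Fin n)) : ℕ :=
  ((pairs n).filter fun x => 2 ≤ x.1 ∧ x.1 < x.2 ∧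
    pext n σ (x.1 - 1) < pext n σ x.2 ∧ pext n σ x.2 < pext n σ x.1).card

/-- `res σ = #{(i,j) : 1 ≤ i < j ≤ n−1, σ(j+1) > σ(i) > σ(j)}`. -/
def resStat (n : ℕ) (σ : Equiv.Perm (Fin n)) : ℕ :=
  ((pairs n).filter fun x => x.1 < x.2 ∧ x.2 ≤ n - 1 ∧
    pext n σ x.2 < pext n σ x.1 ∧ pext n σ x.1 < pext n σ (x.2 + 1)).card

/-- `ress σ = #{(i,j) : 1 ≤ i < j ≤ n−1, σ(j+1) < σ(i) < σ(j)}`. -/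
def ressStat (n : ℕ) (σ : Equiv.Perm (Fin n)) : ℕ :=
  ((pairs n).filter fun x => x.1 < x.2 ∧ x.2 ≤ n - 1 ∧
    pext n σ (x.2 + 1) < pext n σ x.1 ∧ pext n σ x.1 < pext n σ x.2).card

/-! Linear statistics with the boundary convention `σ(0)=σ(n+1)=0` (starred). -/

def peakStar (n : ℕ) (σ : Equiv.Perm (Fin n)) : ℕ :=
  ((Finset.Icc 1 n).filter fun i =>
    pext n σ (i - 1) < pext n σ i ∧ pext n σ (i + 1) < pext n σ i).card

def valleyStar (n : ℕ) (σ : Equiv.Perm (Fin n)) : ℕ :=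
  ((Finset.Icc 1 n).filter fun i =>
    pext n σ i < pext n σ (i - 1) ∧ pext n σ i < pext n σ (i + 1)).card

def daStar (n : ℕ) (σ : Equiv.Perm (Fin n)) : ℕ :=
  ((Finset.Icc 1 n).filter fun i =>
    pext n σ (i - 1) < pext n σ i ∧ pext n σ i < pext n σ (i + 1)).card

def ddStar (n : ℕ) (σ : Equiv.Perm (Fin n)) : ℕ :=
  ((Finset.Icc 1 n).filter fun i =>
    pext n σ (i + 1) < pext n σ i ∧ pext n σ i < pext n σ (i - 1)).card

/-! Linear statistics with the Brändén boundary convention `σ(0)=σ(n+1)=n+1`. -/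

def peakB (n : ℕ) (σ : Equiv.Perm (Fin n)) : ℕ :=
  ((Finset.Icc 1 n).filter fun i =>
    pextB n σ (i - 1) < pextB n σ i ∧ pextB n σ (i + 1) < pextB n σ i).card

def valleyB (n : ℕ) (σ : Equiv.Perm (Fin n)) : ℕ :=
  ((Finset.Icc 1 n).filter fun i =>
    pextB n σ i < pextB n σ (i - 1) ∧ pextB n σ i < pextB n σ (i + 1)).card

def daB (n : ℕ) (σ : Equiv.Perm (Fin n)) : ℕ :=
  ((Finset.Icc 1 n).filter fun i =>
    pextB n σ (i - 1) < pextB n σ i ∧ pextB n σ i < pextB n σ (i + 1)).card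

def ddB (n : ℕ) (σ : Equiv.Perm (Fin n)) : ℕ :=
  ((Finset.Icc 1 n).filter fun i =>
    pextB n σ (i + 1) < pextB n σ i ∧ pextB n σ i < pextB n σ (i - 1)).card

/-! Linear statistics with the boundary convention `σ(0)=0`, `σ(n+1)=n+1`. -/

def valleyC (n : ℕ) (σ : Equiv.Perm (Fin n)) : ℕ :=
  ((Finset.Icc 1 n).filter fun i =>
    pextC n σ i < pextC n σ (i - 1) ∧ pextC n σ i < pextC n σ (i + 1)).card

def daC (n : ℕ) (σ : Equiv.Perm (Fin n)) : ℕ :=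
  ((Finset.Icc 1 n).filter fun i =>
    pextC n σ (i - 1) < pextC n σ i ∧ pextC n σ i < pextC n σ (i + 1)).card

def ddC (n : ℕ) (σ : Equiv.Perm (Fin n)) : ℕ :=
  ((Finset.Icc 1 n).filter fun i =>
    pextC n σ (i + 1) < pextC n σ i ∧ pextC n σ i < pextC n σ (i - 1)).card

/-- `fmax σ`: the number of double ascents (convention `σ(0)=0`, `σ(n+1)=n+1`)
which are left-to-right maxima. -/
def fmaxStat (n : ℕ) (σ : Equiv.Perm (Fin n)) : ℕ :=
  ((Finset.Icc 1 n).filter fun i =>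
    pextC n σ (i - 1) < pextC n σ i ∧ pextC n σ i < pextC n σ (i + 1) ∧
    ∀ j ∈ Finset.Ico 1 i, pext n σ j < pext n σ i).card

/-! Cyclic statistics. -/

def excStat (n : ℕ) (σ : Equiv.Perm (Fin n)) : ℕ :=
  ((Finset.Icc 1 n).filter fun i => i < pext n σ i).card

def wexStat (n : ℕ) (σ : Equiv.Perm (Fin n)) : ℕ :=
  ((Finset.Icc 1 n).filter fun i => i ≤ pext n σ i).card

def dropStat (n : ℕ) (σ : Equiv.Perm (Fin n)) : ℕ :=
  ((Finset.Icc 1 n).filter fun i => pext n σ i < i).card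

def fixStat (n : ℕ) (σ : Equiv.Perm (Fin n)) : ℕ :=
  ((Finset.Icc 1 n).filter fun i => pext n σ i = i).card

/-- cyclic valleys: `x` with `σ⁻¹(x) > x < σ(x)`. -/
def cvalleyStat (n : ℕ) (σ : Equiv.Perm (Fin n)) : ℕ :=
  ((Finset.Icc 1 n).filter fun x => x < pext n σ⁻¹ x ∧ x < pext n σ x).card

/-- double excedances: `x` with `σ⁻¹(x) < x < σ(x)`. -/
def cdaStat (n : ℕ) (σ : Equiv.Perm (Fin n)) : ℕ :=
  ((Finset.Icc 1 n).filter fun x => pext n σ⁻¹ x < x ∧ x < pext n σ x).card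

/-- double drops: `x` with `σ⁻¹(x) > x > σ(x)`. -/
def cddStat (n : ℕ) (σ : Equiv.Perm (Fin n)) : ℕ :=
  ((Finset.Icc 1 n).filter fun x => x < pext n σ⁻¹ x ∧ pext n σ x < x).card

/-- crossings. -/
def crosStat (n : ℕ) (σ : Equiv.Perm (Fin n)) : ℕ :=
  ((pairs n).filter fun x =>
    (x.1 < x.2 ∧ x.2 ≤ pext n σ x.1 ∧ pext n σ x.1 < pext n σ x.2) ∨
    (x.2 < x.1 ∧ pext n σ x.1 < x.2 ∧ pext n σ x.2 < pext n σ x.1)).card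

/-- nestings. -/
def nestStat (n : ℕ) (σ : Equiv.Perm (Fin n)) : ℕ :=
  ((pairs n).filter fun x =>
    (x.1 < x.2 ∧ x.2 ≤ pext n σ x.2 ∧ pext n σ x.2 < pext n σ x.1) ∨
    (x.2 < x.1 ∧ pext n σ x.2 < x.2 ∧ pext n σ x.1 < pext n σ x.2)).card

/-- number of cycles of `σ` (fixed points count as cycles). -/
def cycStat (n : ℕ) (σ : Equiv.Perm (Fin n)) : ℕ :=
  Multiset.card σ.cycleType + (Finset.univ.filter fun x => σ x = x).card

/-! Star statistics: `σ*(i) = σ(i) − 1`, a bijection `[n] → {0,…,n−1}`;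
we extend `σ*` by `0` outside `[1,n]`. -/

def starf (n : ℕ) (σ : Equiv.Perm (Fin n)) (i : ℕ) : ℕ :=
  if 1 ≤ i ∧ i ≤ n then pext n σ i - 1 else 0

/-- `(σ*)⁻¹(i) = σ⁻¹(i+1)`, defined for `0 ≤ i ≤ n−1`. -/
def invstarf (n : ℕ) (σ : Equiv.Perm (Fin n)) (i : ℕ) : ℕ :=
  pext n σ⁻¹ (i + 1)

def dropStarStat (n : ℕ) (σ : Equiv.Perm (Fin n)) : ℕ :=
  ((Finset.Icc 1 n).filter fun i => starf n σ i < i).card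

def fixStarStat (n : ℕ) (σ : Equiv.Perm (Fin n)) : ℕ :=
  ((Finset.Icc 1 n).filter fun i => starf n σ i = i).card

def wexStarStat (n : ℕ) (σ : Equiv.Perm (Fin n)) : ℕ :=
  ((Finset.Icc 1 n).filter fun i => i ≤ starf n σ i).card

def cdaStarStat (n : ℕ) (σ : Equiv.Perm (Fin n)) : ℕ :=
  ((Finset.Icc 1 n).filter fun i => invstarf n σ i < i ∧ i < starf n σ i).card

def cddStarStat (n : ℕ) (σ : Equiv.Perm (Fin n)) : ℕ :=
  ((Finset.Icc 1 n).filter fun i => i < invstarf n σ i ∧ starf n σ i < i).card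

def cvalleyStarStat (n : ℕ) (σ : Equiv.Perm (Fin n)) : ℕ :=
  ((Finset.Icc 1 n).filter fun i => i < invstarf n σ i ∧ i < starf n σ i).card

def crosStarStat (n : ℕ) (σ : Equiv.Perm (Fin n)) : ℕ :=
  ((pairs n).filter fun x =>
    (x.1 < x.2 ∧ x.2 ≤ starf n σ x.1 ∧ starf n σ x.1 < starf n σ x.2) ∨
    (x.2 < x.1 ∧ starf n σ x.1 < x.2 ∧ starf n σ x.2 < starf n σ x.1)).card

def nestStarStat (n : ℕ) (σ : Equiv.Perm (Fin n)) : ℕ :=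
  ((pairs n).filter fun x =>
    (x.1 < x.2 ∧ x.2 ≤ starf n σ x.2 ∧ starf n σ x.2 < starf n σ x.1) ∨
    (x.2 < x.1 ∧ starf n σ x.2 < x.2 ∧ starf n σ x.1 < starf n σ x.2)).card

/-- `cyc* σ`: the number of cycles of the functional digraph of `σ*` on `[n]`,
counted as the number of `i ∈ [1,n]` that lie on a cycle of `σ*` and are
minimal in their cycle. (The component of `σ*` that is a path from `n` to `0`
contributes no such `i`.) -/
def cycStarStat (n : ℕ) (σ : Equiv.Perm (Fin n)) : ℕ :=
  ((Finset.Icc 1 n).filter fun i =>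
    (∃ m ∈ Finset.Icc 1 n, (starf n σ)^[m] i = i) ∧
    ∀ m ∈ Finset.range (n + 1), i ≤ (starf n σ)^[m] i).card

/-! Motzkin paths, encoded as step sequences `γ : Fin m → Fin 3`
(`0` = up step `(1,1)`, `1` = level step `(1,0)`, `2` = down step `(1,−1)`). -/

/-- The height (ordinate) of the path after `i` steps. -/
def hgt (m : ℕ) (γ : Fin m → Fin 3) (i : ℕ) : ℤ :=
  ∑ j ∈ Finset.range i, if hj : j < m then 1 - ((γ ⟨j, hj⟩ : ℕ) : ℤ) else 0

/-- A step sequence is a Motzkin path if it never goes below the x-axis and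
ends at height `0`. -/
def IsMotzkin (m : ℕ) (γ : Fin m → Fin 3) : Prop :=
  (∀ i ≤ m, 0 ≤ hgt m γ i) ∧ hgt m γ m = 0

/-- The (finite) set of Motzkin paths of length `m`. -/
def motzkin (m : ℕ) : Finset (Fin m → Fin 3) :=
  Finset.univ.filter fun γ => IsMotzkin m γ

/-- number of up (North-East) steps. -/
def neCount (m : ℕ) (γ : Fin m → Fin 3) : ℕ :=
  (Finset.univ.filter fun i => γ i = 0).card

/-- number of level (East) steps. -/
def eCount (m : ℕ) (γ : Fin m → Fin 3) : ℕ :=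
  (Finset.univ.filter fun i => γ i = 1).card

/-- the `(p,q)`-integer `[m]_{p,q} = p^{m−1} + p^{m−2}q + ⋯ + q^{m−1}`. -/
def pqInt {R : Type*} [CommRing R] (p q : R) (m : ℕ) : R :=
  ∑ j ∈ Finset.range m, p ^ (m - 1 - j) * q ^ j

/-- The permutation with `a ↦ b` that restricts to `τ` after deleting `a` and `b`. -/
def insPerm {N : ℕ} (a b : Fin (N + 1)) (τ : Equiv.Perm (Fin N)) : Equiv.Perm (Fin (N + 1)) :=
  (finSuccEquiv' a).trans ((Equiv.optionCongr τ).trans (finSuccEquiv' b).symm)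

@[simp] lemma insPerm_self {N : ℕ} (a b : Fin (N + 1)) (τ : Equiv.Perm (Fin N)) :
    insPerm a b τ a = b := by
  simp [insPerm]

@[simp] lemma insPerm_succAbove {N : ℕ} (a b : Fin (N + 1)) (τ : Equiv.Perm (Fin N)) (i : Fin N) :
    insPerm a b τ (a.succAbove i) = b.succAbove (τ i) := by
  simp [insPerm]

lemma insPerm_injective {N : ℕ} {a b : Fin (N + 1)} {τ τ' : Equiv.Perm (Fin N)}
    (h : insPerm a b τ = insPerm a b τ') : τ = τ' := by
  ext i
  have := congrArg (fun σ : Equiv.Perm (Fin (N + 1)) => σ (a.succAbove i)) h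
  simp only [insPerm_succAbove] at this
  rw [Fin.succAbove_right_injective this]

lemma card_fin_prod_perm (N : ℕ) :
    Fintype.card (Fin (N + 1) × Equiv.Perm (Fin N)) = Fintype.card (Equiv.Perm (Fin (N + 1))) := by
  simp [Fintype.card_perm, Nat.factorial_succ]

lemma sum_perm_position {M : Type*} [AddCommMonoid M] {N : ℕ} (a : Fin (N + 1))
    (f : Equiv.Perm (Fin (N + 1)) → M) :
    ∑ σ, f σ = ∑ b, ∑ τ, f (insPerm a b τ) := by
  rw [← Fintype.sum_prod_type (fun x : Fin (N + 1) × Equiv.Perm (Fin N) => f (insPerm a x.1 x.2))]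
  symm
  refine Function.Bijective.sum_comp
    (e := fun x : Fin (N + 1) × Equiv.Perm (Fin N) => insPerm a x.1 x.2) ?_ f
  refine (Fintype.bijective_iff_injective_and_card _).2 ⟨?_, card_fin_prod_perm N⟩
  rintro ⟨b, τ⟩ ⟨b', τ'⟩ h
  have hb : b = b' := by
    have := congrArg (fun σ : Equiv.Perm (Fin (N + 1)) => σ a) h
    simpa using this
  subst hb
  obtain rfl := insPerm_injective h
  rfl

lemma sum_perm_value {M : Type*} [AddCommMonoid M] {N : ℕ} (b : Fin (N + 1))
    (f : Equiv.Perm (Fin (N + 1)) → M) :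
    ∑ σ, f σ = ∑ a, ∑ τ, f (insPerm a b τ) := by
  rw [← Fintype.sum_prod_type (fun x : Fin (N + 1) × Equiv.Perm (Fin N) => f (insPerm x.1 b x.2))]
  symm
  refine Function.Bijective.sum_comp
    (e := fun x : Fin (N + 1) × Equiv.Perm (Fin N) => insPerm x.1 b x.2) ?_ f
  refine (Fintype.bijective_iff_injective_and_card _).2 ⟨?_, card_fin_prod_perm N⟩
  rintro ⟨a, τ⟩ ⟨a', τ'⟩ h
  have ha : a = a' := by
    have h1 : insPerm a b τ a = insPerm a' b τ' a' := by simp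
    have h2 : insPerm a b τ = insPerm a' b τ' := h
    rw [h2] at h1
    exact (insPerm a' b τ').injective h1
  subst ha
  obtain rfl := insPerm_injective h
  rfl

lemma val_succAbove {N : ℕ} (a : Fin (N + 1)) (i : Fin N) :
    (a.succAbove i : ℕ) = if (i : ℕ) < a then (i : ℕ) else i + 1 := by
  unfold Fin.succAbove
  simp only [Fin.lt_def, Fin.val_castSucc]
  split_ifs <;> simp

lemma forall_fin_succAbove {N : ℕ} (a : Fin (N + 1)) (P : Fin (N + 1) → Prop) :
    (∀ i, P i) ↔ P a ∧ ∀ i, P (a.succAbove i) := by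
  constructor
  · exact fun h => ⟨h a, fun i => h _⟩
  · rintro ⟨h, h'⟩ i
    rcases eq_or_ne i a with rfl | hi
    · exact h
    · obtain ⟨j, rfl⟩ := Fin.exists_succAbove_eq hi
      exact h' j

/-- `[i, j]` with images `s, t` is a crossing. -/
def IsCross (i j s t : ℕ) : Prop := (i < j ∧ j ≤ s ∧ s < t) ∨ (j < i ∧ s < j ∧ t < s)

/-- `[i, j]` with images `s, t` is a nesting. -/
def IsNest (i j s t : ℕ) : Prop := (i < j ∧ j ≤ t ∧ t < s) ∨ (j < i ∧ t < j ∧ s < t)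

/-- The number of pairs `(i, j)` of positions whose positions and values satisfy `P`. -/
def pairCount (P : ℕ → ℕ → ℕ → ℕ → Prop) {N : ℕ} (σ : Equiv.Perm (Fin N)) : ℕ :=
  ∑ i : Fin N, ∑ j : Fin N, if P i j (σ i) (σ j) then 1 else 0

/-- The number of weak excedances. -/
def wexCount {N : ℕ} (σ : Equiv.Perm (Fin N)) : ℕ :=
  ∑ i : Fin N, if (i : ℕ) ≤ σ i then 1 else 0

lemma wexCount_insPerm {N : ℕ} (a b : Fin (N + 1)) (τ : Equiv.Perm (Fin N)) :
    wexCount (insPerm a b τ) = (if (a : ℕ) ≤ b then 1 else 0) +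
      ∑ i, if (a.succAbove i : ℕ) ≤ b.succAbove (τ i) then 1 else 0 := by
  simp [wexCount, Fin.sum_univ_succAbove _ a]

lemma pairCount_insPerm (P : ℕ → ℕ → ℕ → ℕ → Prop) {N : ℕ} (a b : Fin (N + 1))
    (τ : Equiv.Perm (Fin N)) (hP : ∀ i s, ¬ P i i s s) :
    pairCount P (insPerm a b τ) =
      (∑ i, ((if P a (a.succAbove i) b (b.succAbove (τ i)) then 1 else 0) +
        (if P (a.succAbove i) a (b.succAbove (τ i)) b then 1 else 0))) +
      ∑ i, ∑ j, if P (a.succAbove i) (a.succAbove j) (b.succAbove (τ i)) (b.succAbove (τ j))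
        then 1 else 0 := by
  simp only [pairCount, Fin.sum_univ_succAbove _ a, insPerm_self, insPerm_succAbove, hP, if_false,
    Finset.sum_add_distrib]
  ring

lemma not_isCross_self (i s : ℕ) : ¬ IsCross i i s s := by unfold IsCross; omega
lemma not_isNest_self (i s : ℕ) : ¬ IsNest i i s s := by unfold IsNest; omega

lemma sum_fin_Ico (N u v : ℕ) (hv : v ≤ N) :
    (∑ j : Fin N, if u ≤ (j : ℕ) ∧ (j : ℕ) < v then 1 else 0) = v - u := by
  rw [Fin.sum_univ_eq_sum_range (fun j => if u ≤ j ∧ j < v then 1 else 0) N, ← Finset.sum_filter]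
  have : (Finset.range N).filter (fun j => u ≤ j ∧ j < v) = Finset.Ico u v := by
    ext j; simp; omega
  simp [this]

section signed

variable {R : Type*} [CommRing R] (p q : R)

/-- The signed weight `(-1)^wex p^nest q^cros`. -/
def cycWeight {N : ℕ} (σ : Equiv.Perm (Fin N)) : R :=
  (-1) ^ wexCount σ * p ^ pairCount IsNest σ * q ^ pairCount IsCross σ

/-- Signed sum over permutations mapping the first `h` positions to values at least `h`. -/
def evenSum (N h : ℕ) : R :=
  ∑ σ : Equiv.Perm (Fin N), if ∀ i : Fin N, (i : ℕ) < h → h ≤ σ i then cycWeight p q σ else 0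

/-- Signed sum over permutations mapping the first `h` positions to values at least `h - 1`. -/
def oddSum (N h : ℕ) : R :=
  ∑ σ : Equiv.Perm (Fin N), if ∀ i : Fin N, (i : ℕ) < h → h ≤ σ i + 1 then cycWeight p q σ else 0

lemma cycWeight_insPerm_upper {N : ℕ} (h : ℕ) (hN : h ≤ N) (a : Fin (N + 1)) (ha : (a : ℕ) ≤ h)
    (τ : Equiv.Perm (Fin N)) (hτ : ∀ i : Fin N, (i : ℕ) < h → h ≤ τ i) :
    cycWeight p q (insPerm a ⟨h, by omega⟩ τ) =
      - (p ^ (a : ℕ) * q ^ (h - a)) * cycWeight p q τ := by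
  have h1 : wexCount (insPerm a ⟨h, by omega⟩ τ) = 1 + wexCount τ := by
    rw [wexCount_insPerm, wexCount]
    congr 1
    · simp [ha]
    · refine Finset.sum_congr rfl fun i _ => if_congr ?_ rfl rfl
      have := hτ i
      simp only [val_succAbove]
      split_ifs <;> omega
  have h2 : pairCount IsNest (insPerm a ⟨h, by omega⟩ τ) = a + pairCount IsNest τ := by
    rw [pairCount_insPerm _ _ _ _ not_isNest_self, pairCount]
    congr 1
    · refine Eq.trans ?_ ((sum_fin_Ico N 0 a (by omega)).trans (Nat.sub_zero _))
      refine Finset.sum_congr rfl fun i _ => ?_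
      have := hτ i
      simp only [val_succAbove, IsNest]
      split_ifs <;> omega
    · refine Finset.sum_congr rfl fun i _ => Finset.sum_congr rfl fun j _ => if_congr ?_ rfl rfl
      have := hτ i
      have := hτ j
      simp only [val_succAbove, IsNest]
      split_ifs <;> omega
  have h3 : pairCount IsCross (insPerm a ⟨h, by omega⟩ τ) = (h - a) + pairCount IsCross τ := by
    rw [pairCount_insPerm _ _ _ _ not_isCross_self, pairCount]
    congr 1
    · rw [← sum_fin_Ico N a h (by omega)]
      refine Finset.sum_congr rfl fun i _ => ?_
      have := hτ i
      simp only [val_succAbove, IsCross]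
      split_ifs <;> omega
    · refine Finset.sum_congr rfl fun i _ => Finset.sum_congr rfl fun j _ => if_congr ?_ rfl rfl
      have := hτ i
      have := hτ j
      simp only [val_succAbove, IsCross]
      split_ifs <;> omega
  simp only [cycWeight, h1, h2, h3, pow_add]
  ring

lemma cycWeight_insPerm_lower {N : ℕ} (h : ℕ) (hN : h ≤ N) (b : Fin (N + 1)) (hb : (b : ℕ) < h)
    (τ : Equiv.Perm (Fin N)) (hτ : ∀ i : Fin N, (i : ℕ) < h → h ≤ τ i + 1) :
    cycWeight p q (insPerm ⟨h, by omega⟩ b τ) =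
      (p ^ (b : ℕ) * q ^ (h - 1 - b)) * cycWeight p q τ := by
  have h1 : wexCount (insPerm ⟨h, by omega⟩ b τ) = 0 + wexCount τ := by
    rw [wexCount_insPerm, wexCount]
    congr 1
    · simp [hb]
    · refine Finset.sum_congr rfl fun i _ => if_congr ?_ rfl rfl
      have := hτ i
      simp only [val_succAbove]
      split_ifs <;> omega
  have h2 : pairCount IsNest (insPerm ⟨h, by omega⟩ b τ) = b + pairCount IsNest τ := by
    rw [pairCount_insPerm _ _ _ _ not_isNest_self, pairCount]
    congr 1
    · refine Eq.trans ?_ ((sum_fin_Ico N 0 b (by omega)).trans (Nat.sub_zero _))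
      rw [← Equiv.sum_comp τ (fun j : Fin N => if 0 ≤ (j : ℕ) ∧ (j : ℕ) < b then 1 else 0)]
      refine Finset.sum_congr rfl fun i _ => ?_
      have := hτ i
      simp only [val_succAbove, IsNest]
      split_ifs <;> omega
    · refine Finset.sum_congr rfl fun i _ => Finset.sum_congr rfl fun j _ => if_congr ?_ rfl rfl
      have := hτ i
      have := hτ j
      simp only [val_succAbove, IsNest]
      split_ifs <;> omega
  have h3 : pairCount IsCross (insPerm ⟨h, by omega⟩ b τ) = (h - 1 - b) + pairCount IsCross τ := by
    rw [pairCount_insPerm _ _ _ _ not_isCross_self, pairCount]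
    congr 1
    · rw [← sum_fin_Ico N b (h - 1) (by omega),
        ← Equiv.sum_comp τ (fun j : Fin N => if (b : ℕ) ≤ (j : ℕ) ∧ (j : ℕ) < h - 1 then 1 else 0)]
      refine Finset.sum_congr rfl fun i _ => ?_
      have := hτ i
      simp only [val_succAbove, IsCross]
      split_ifs <;> omega
    · refine Finset.sum_congr rfl fun i _ => Finset.sum_congr rfl fun j _ => if_congr ?_ rfl rfl
      have := hτ i
      have := hτ j
      simp only [val_succAbove, IsCross]
      split_ifs <;> omega
  simp only [cycWeight, h1, h2, h3, pow_add]
  ring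

lemma sum_fin_pqInt (N m : ℕ) (hm : m ≤ N) :
    (∑ a : Fin N, if (a : ℕ) < m then p ^ (a : ℕ) * q ^ (m - 1 - a) else 0) = pqInt p q m := by
  rw [Fin.sum_univ_eq_sum_range (fun a => if a < m then p ^ a * q ^ (m - 1 - a) else 0) N,
    ← Finset.sum_filter]
  have : (Finset.range N).filter (fun a => a < m) = Finset.range m := by
    ext j; simp; omega
  rw [this, pqInt, ← Finset.sum_range_reflect]
  refine Finset.sum_congr rfl fun j hj => ?_
  have := Finset.mem_range.1 hj
  rw [show m - 1 - (m - 1 - j) = j by omega]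

lemma evenSum_succ (N h : ℕ) (hN : h ≤ N) :
    evenSum p q (N + 1) h = oddSum p q (N + 1) (h + 1) + pqInt p q h * oddSum p q N h := by
  rw [← sub_eq_iff_eq_add', ← sum_fin_pqInt p q (N + 1) h (by omega), evenSum, oddSum, oddSum,
    ← Finset.sum_sub_distrib, sum_perm_position ⟨h, by omega⟩, Finset.sum_mul]
  refine Finset.sum_congr rfl fun b _ => ?_
  rw [Finset.mul_sum]
  refine Finset.sum_congr rfl fun τ _ => ?_
  simp only [forall_fin_succAbove (⟨h, by omega⟩ : Fin (N + 1)), insPerm_self, insPerm_succAbove]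
  by_cases hb : (b : ℕ) < h
  · have hc : ((((⟨h, by omega⟩ : Fin (N + 1)) : ℕ) < h → h ≤ (b : ℕ)) ∧ ∀ i : Fin N,
        ((Fin.succAbove (⟨h, by omega⟩ : Fin (N + 1)) i : Fin (N + 1)) : ℕ) < h →
          h ≤ (b.succAbove (τ i) : ℕ)) ↔ ∀ i : Fin N, (i : ℕ) < h → h ≤ τ i + 1 := by
      simp only [val_succAbove]
      refine ⟨fun H i hi => ?_, fun H => ⟨by simp, fun i => ?_⟩⟩
      · have := H.2 i
        split_ifs at this <;> omega
      · have := H i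
        split_ifs <;> omega
    have hd : ¬ ((((⟨h, by omega⟩ : Fin (N + 1)) : ℕ) < h + 1 → h + 1 ≤ (b : ℕ) + 1) ∧ ∀ i : Fin N,
        ((Fin.succAbove (⟨h, by omega⟩ : Fin (N + 1)) i : Fin (N + 1)) : ℕ) < h + 1 →
          h + 1 ≤ (b.succAbove (τ i) : ℕ) + 1) := by
      rintro ⟨H, -⟩
      have := H (Nat.lt_succ_self h)
      omega
    simp only [hc, if_neg hd, if_pos hb, sub_zero]
    split_ifs with hτ
    · rw [cycWeight_insPerm_lower p q h hN b hb τ hτ]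
    · simp
  · rw [if_neg hb, zero_mul, sub_eq_zero]
    refine if_congr (and_congr (by simp; omega) (forall_congr' fun i => ?_)) rfl rfl
    simp only [val_succAbove]
    split_ifs <;> omega

lemma oddSum_succ (N h : ℕ) (hN : h ≤ N) :
    oddSum p q (N + 1) (h + 1) =
      evenSum p q (N + 1) (h + 1) - pqInt p q (h + 1) * evenSum p q N h := by
  rw [eq_sub_iff_add_eq, ← eq_sub_iff_add_eq', ← sum_fin_pqInt p q (N + 1) (h + 1) (by omega),
    evenSum, evenSum, oddSum, ← Finset.sum_sub_distrib, sum_perm_value ⟨h, by omega⟩,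
    Finset.sum_mul]
  refine Finset.sum_congr rfl fun a _ => ?_
  rw [Finset.mul_sum]
  refine Finset.sum_congr rfl fun τ _ => ?_
  simp only [forall_fin_succAbove a, insPerm_self, insPerm_succAbove]
  by_cases ha : (a : ℕ) < h + 1
  · have hc : (((a : ℕ) < h + 1 → h + 1 ≤ h + 1) ∧ ∀ i : Fin N,
        ((Fin.succAbove a i : Fin (N + 1)) : ℕ) < h + 1 →
          h + 1 ≤ ((Fin.succAbove (⟨h, by omega⟩ : Fin (N + 1)) (τ i) : Fin (N + 1)) : ℕ) + 1) ↔
          ∀ i : Fin N, (i : ℕ) < h → h ≤ τ i := by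
      simp only [val_succAbove]
      refine ⟨fun H i hi => ?_, fun H => ⟨by simp, fun i => ?_⟩⟩
      · have := H.2 i
        split_ifs at this <;> omega
      · have := H i
        split_ifs <;> omega
    have hd : ¬ (((a : ℕ) < h + 1 → h + 1 ≤ h) ∧ ∀ i : Fin N,
        ((Fin.succAbove a i : Fin (N + 1)) : ℕ) < h + 1 →
          h + 1 ≤ ((Fin.succAbove (⟨h, by omega⟩ : Fin (N + 1)) (τ i) : Fin (N + 1)) : ℕ)) := by
      rintro ⟨H, -⟩
      have := H ha
      omega
    simp only [hc, if_neg hd, if_pos ha, zero_sub]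
    split_ifs with hτ
    · rw [cycWeight_insPerm_upper p q h hN a (by omega) τ hτ]
      simp
    · simp
  · rw [if_neg ha, zero_mul, eq_comm, sub_eq_zero]
    refine if_congr (and_congr (by simp; omega) (forall_congr' fun i => ?_)) rfl rfl
    simp only [val_succAbove]
    split_ifs <;> omega

lemma evenSum_self (N : ℕ) : evenSum p q (N + 1) (N + 1) = 0 := by
  refine Finset.sum_eq_zero fun σ _ => if_neg fun H => ?_
  have := H 0 (by simp)
  omega

lemma oddSum_add_two (N h : ℕ) (hN : h ≤ N) :
    oddSum p q (N + 2) (h + 1) = oddSum p q (N + 2) (h + 2) -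
      pqInt p q h * pqInt p q (h + 1) * oddSum p q N h := by
  rw [oddSum_succ p q (N + 1) h (by omega), evenSum_succ p q (N + 1) (h + 1) (by omega),
    evenSum_succ p q N h hN]
  ring

lemma oddSum_self (N : ℕ) : oddSum p q (N + 2) (N + 2) = 0 := by
  rw [oddSum_succ p q (N + 1) (N + 1) le_rfl, evenSum_self, evenSum_self]
  ring

lemma oddSum_one : oddSum p q 1 1 = -1 := by
  rw [oddSum_succ p q 0 0 le_rfl, evenSum_self]
  simp [evenSum, cycWeight, pqInt, wexCount, pairCount]

lemma oddSum_even (N h : ℕ) (hh : 1 ≤ h) (hN : h ≤ 2 * N) : oddSum p q (2 * N) h = 0 := by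
  induction N generalizing h with
  | zero => omega
  | succ N ih =>
    induction hN using Nat.decreasingInduction with
    | self => exact oddSum_self p q (2 * N)
    | of_succ k hk IH =>
      obtain ⟨k, rfl⟩ : ∃ l, k = l + 1 := ⟨k - 1, by omega⟩
      rw [show 2 * (N + 1) = 2 * N + 2 by ring] at hk IH ⊢
      rw [oddSum_add_two p q (2 * N) k (by omega), IH (by omega)]
      rcases Nat.eq_zero_or_pos k with rfl | h0
      · simp [pqInt]
      · rw [ih k h0 (by omega)]
        simp

lemma sum_cycWeight (N : ℕ) : ∑ σ : Equiv.Perm (Fin N), cycWeight p q σ = oddSum p q N 1 := by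
  refine Finset.sum_congr rfl fun σ _ => ?_
  rw [if_pos]
  intros
  omega

end signed

/-- The number of descents across the value `σ j` to the left of `j`, for an alternating `σ`,
written as an alternating sum over positions. -/
def leftHt {N : ℕ} (σ : Equiv.Perm (Fin N)) (j : Fin N) : ℤ :=
  (∑ x : Fin N, if (x : ℕ) < j ∧ (σ j : ℕ) < σ x then (-1) ^ (x : ℕ) else 0) -
    if (j : ℕ) % 2 = 1 then 1 else 0

/-- The number of ascents across the value `σ j` to the right of `j`, for an alternating `σ`,
written as an alternating sum over positions. -/
def rightHt {N : ℕ} (σ : Equiv.Perm (Fin N)) (j : Fin N) : ℤ :=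
  (∑ x : Fin N, if (j : ℕ) < x ∧ (σ j : ℕ) < σ x then (-1) ^ (x : ℕ) else 0) -
    if (j : ℕ) % 2 = 1 then 1 else 0

/-- Alternating permutations `σ 0 > σ 1 < σ 2 > ⋯`. -/
def IsAlt {N : ℕ} (σ : Equiv.Perm (Fin N)) : Prop :=
  ∀ i j : Fin N, (j : ℕ) = i + 1 →
    ((i : ℕ) % 2 = 0 → (σ j : ℕ) < σ i) ∧ ((i : ℕ) % 2 = 1 → (σ i : ℕ) < σ j)

/-- Alternating permutations with all values at least `k` in even positions. -/
def InClass (k : ℕ) {N : ℕ} (σ : Equiv.Perm (Fin N)) : Prop :=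
  IsAlt σ ∧ ∀ x : Fin N, k ≤ σ x → (x : ℕ) % 2 = 0

lemma sum_card_filter_pqInt {R : Type*} [CommRing R] (p q : R) {N : ℕ} (S : Finset (Fin N)) :
    ∑ x ∈ S, p ^ (S.filter fun y => x < y).card * q ^ (S.filter fun y => y < x).card =
      pqInt p q S.card := by
  induction S using Finset.induction_on_max with
  | empty => simp [pqInt]
  | insert a S ha ih =>
    have haS : a ∉ S := fun h => lt_irrefl _ (ha a h)
    rw [Finset.sum_insert haS, Finset.card_insert_of_notMem haS, pqInt, Finset.sum_range_succ,
      add_comm]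
    congr 1
    · have h1 : ∀ x ∈ S, p ^ ((insert a S).filter fun y => x < y).card *
          q ^ ((insert a S).filter fun y => y < x).card =
          p * (p ^ (S.filter fun y => x < y).card * q ^ (S.filter fun y => y < x).card) := by
        intro x hx
        rw [Finset.filter_insert, if_pos (ha x hx), Finset.filter_insert,
          if_neg (ha x hx).le.not_gt, Finset.card_insert_of_notMem (by simp [haS]), pow_succ]
        ring
      rw [Finset.sum_congr rfl h1, ← Finset.mul_sum, ih, pqInt, Finset.mul_sum]
      refine Finset.sum_congr rfl fun j hj => ?_
      have := Finset.mem_range.1 hj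
      rw [show S.card + 1 - 1 - j = (S.card - 1 - j) + 1 by omega, pow_succ]
      ring
    · have h1 : (insert a S).filter (fun y => a < y) = ∅ := by
        ext y
        simp only [Finset.mem_filter, Finset.mem_insert, Finset.notMem_empty, iff_false, not_and]
        rintro (rfl | h)
        · exact lt_irrefl _
        · exact (ha y h).not_gt
      have h2 : (insert a S).filter (fun y => y < a) = S := by
        ext y
        simp only [Finset.mem_filter, Finset.mem_insert]
        constructor
        · rintro ⟨rfl | h, h'⟩
          · exact absurd h' (lt_irrefl _)
          · exact h
        · exact fun h => ⟨Or.inr h, ha y h⟩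
      rw [h1, h2]
      simp

lemma card_filter_le_perm {N : ℕ} (k : ℕ) (σ : Equiv.Perm (Fin N)) :
    (Finset.univ.filter fun x : Fin N => k ≤ (σ x : ℕ)).card = N - k := by
  rw [Finset.card_filter, Equiv.sum_comp σ (fun x : Fin N => if k ≤ (x : ℕ) then 1 else 0),
    ← sum_fin_Ico N k N le_rfl]
  exact Finset.sum_congr rfl fun x _ => if_congr (by simp) rfl rfl

section alternating

variable {R : Type*} [CommRing R] (p q : R)

/-- The part of `p^res q^les` contributed by the values below `k`. -/
def altWeight (k : ℕ) {N : ℕ} (σ : Equiv.Perm (Fin N)) : R :=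
  ∏ j : Fin N, if (σ j : ℕ) < k then p ^ (rightHt σ j).toNat * q ^ (leftHt σ j).toNat else 1

/-- `p` and `q` raised to the numbers of values at least `k` on either side of `x`. -/
def slotWeight (k : ℕ) {N : ℕ} (σ : Equiv.Perm (Fin N)) (x : Fin N) : R :=
  p ^ (Finset.univ.filter fun y : Fin N => x < y ∧ k ≤ (σ y : ℕ)).card *
    q ^ (Finset.univ.filter fun y : Fin N => y < x ∧ k ≤ (σ y : ℕ)).card

/-- Weighted sum over alternating permutations with values at least `k` in even positions. -/
def altSum (N k : ℕ) : R :=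
  ∑ σ : Equiv.Perm (Fin N), if InClass k σ then altWeight p q k σ else 0

lemma sum_slotWeight (k : ℕ) {N : ℕ} (σ : Equiv.Perm (Fin N)) :
    (∑ x, if k ≤ (σ x : ℕ) then slotWeight p q k σ x else 0) = pqInt p q (N - k) := by
  rw [← card_filter_le_perm k σ, ← sum_card_filter_pqInt, ← Finset.sum_filter]
  refine Finset.sum_congr rfl fun x _ => ?_
  simp only [slotWeight, Finset.filter_filter, and_comm]

lemma altWeight_succ {k N : ℕ} {σ : Equiv.Perm (Fin N)} (hσ : InClass k σ) {x : Fin N}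
    (hx : (σ x : ℕ) = k) :
    altWeight p q (k + 1) σ = altWeight p q k σ * slotWeight p q k σ x := by
  have hpar := hσ.2
  have hpow : ∀ y : Fin N, k < (σ y : ℕ) → (-1 : ℤ) ^ (y : ℕ) = 1 := fun y hy =>
    Even.neg_one_pow (Nat.even_iff.2 (hpar y hy.le))
  have hne : ∀ y : Fin N, y ≠ x → (σ y : ℕ) ≠ k := fun y hy h =>
    hy (σ.injective (Fin.ext (h.trans hx.symm)))
  have hR : rightHt σ x = (Finset.univ.filter fun y : Fin N => x < y ∧ k ≤ (σ y : ℕ)).card := by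
    rw [rightHt, if_neg (by have := hpar x hx.ge; omega), sub_zero, Finset.card_filter, hx]
    push_cast
    refine Finset.sum_congr rfl fun y _ => ?_
    by_cases h : x < y
    · have := hne y h.ne'
      by_cases h' : k < (σ y : ℕ)
      · rw [if_pos ⟨h, h'⟩, if_pos ⟨h, h'.le⟩, hpow y h']
      · rw [if_neg (by tauto), if_neg (by omega)]
    · rw [if_neg (fun h' => h h'.1), if_neg (fun h' => h h'.1)]
  have hL : leftHt σ x = (Finset.univ.filter fun y : Fin N => y < x ∧ k ≤ (σ y : ℕ)).card := by
    rw [leftHt, if_neg (by have := hpar x hx.ge; omega), sub_zero, Finset.card_filter, hx]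
    push_cast
    refine Finset.sum_congr rfl fun y _ => ?_
    by_cases h : y < x
    · have := hne y h.ne
      by_cases h' : k < (σ y : ℕ)
      · rw [if_pos ⟨h, h'⟩, if_pos ⟨h, h'.le⟩, hpow y h']
      · rw [if_neg (by tauto), if_neg (by omega)]
    · rw [if_neg (fun h' => h h'.1), if_neg (fun h' => h h'.1)]
  have hprod : slotWeight p q k σ x = ∏ j : Fin N, if j = x then slotWeight p q k σ j else 1 := by
    simp
  rw [hprod, altWeight, altWeight, ← Finset.prod_mul_distrib]
  refine Finset.prod_congr rfl fun j _ => ?_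
  by_cases hj : j = x
  · subst hj
    rw [if_pos (by omega), if_neg (by omega), if_pos rfl, hR, hL]
    simp [slotWeight]
  · have := hne j hj
    rw [if_neg hj, mul_one]
    exact if_congr (by omega) rfl rfl

lemma InClass.of_agree {k N : ℕ} {σ σ' : Equiv.Perm (Fin N)}
    (h : ∀ x, (σ x : ℕ) = σ' x ∨ (k ≤ (σ x : ℕ) ∧ k ≤ (σ' x : ℕ)))
    (hσ : InClass k σ) : InClass k σ' := by
  have hpar : ∀ x : Fin N, k ≤ (σ' x : ℕ) → (x : ℕ) % 2 = 0 := fun x hx =>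
    hσ.2 x (by rcases h x with h' | h' <;> omega)
  refine ⟨fun i j hij => ?_, hpar⟩
  have h1 := hσ.1 i j hij
  have h2 := h i
  have h3 := h j
  have h4 := hpar i
  have h5 := hpar j
  constructor <;> intro h6 <;> omega

lemma altWeight_congr_of_agree {k N : ℕ} {σ σ' : Equiv.Perm (Fin N)}
    (h : ∀ x, (σ x : ℕ) = σ' x ∨ (k ≤ (σ x : ℕ) ∧ k ≤ (σ' x : ℕ))) :
    altWeight p q k σ' = altWeight p q k σ := by
  refine Finset.prod_congr rfl fun j _ => ?_
  have hj := h j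
  by_cases hlt : (σ j : ℕ) < k
  · rw [if_pos (by omega), if_pos hlt]
    have hc : ∀ x, (σ' j : ℕ) < σ' x ↔ (σ j : ℕ) < σ x := fun x => by
      have := h x
      omega
    simp only [rightHt, leftHt, hc]
  · rw [if_neg (by omega), if_neg hlt]

lemma slotWeight_congr_of_agree {k N : ℕ} {σ σ' : Equiv.Perm (Fin N)}
    (h : ∀ x, (σ x : ℕ) = σ' x ∨ (k ≤ (σ x : ℕ) ∧ k ≤ (σ' x : ℕ)))
    (x : Fin N) :
    slotWeight p q k σ' x = slotWeight p q k σ x := by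
  have hc : ∀ y, k ≤ (σ' y : ℕ) ↔ k ≤ (σ y : ℕ) := fun y => by
    have := h y
    omega
  simp only [slotWeight, hc]

lemma sum_slotWeight_inv_apply {k N : ℕ} (v w : Fin N) (hv : k ≤ (v : ℕ)) (hw : k ≤ (w : ℕ)) :
    (∑ σ : Equiv.Perm (Fin N),
      if InClass k σ then altWeight p q k σ * slotWeight p q k σ (σ⁻¹ v) else 0) =
    ∑ σ : Equiv.Perm (Fin N),
      if InClass k σ then altWeight p q k σ * slotWeight p q k σ (σ⁻¹ w) else 0 := by
  rw [← Equiv.sum_comp (Equiv.mulLeft (Equiv.swap v w))]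
  refine Finset.sum_congr rfl fun σ _ => ?_
  have hag : ∀ x, (σ x : ℕ) = (Equiv.swap v w * σ) x ∨
      (k ≤ (σ x : ℕ) ∧ k ≤ ((Equiv.swap v w * σ) x : ℕ)) := fun x => by
    rw [Equiv.Perm.mul_apply]
    by_cases h1 : σ x = v
    · right
      rw [h1, Equiv.swap_apply_left]
      exact ⟨hv, hw⟩
    by_cases h2 : σ x = w
    · right
      rw [h2, Equiv.swap_apply_right]
      exact ⟨hw, hv⟩
    left
    rw [Equiv.swap_apply_of_ne_of_ne h1 h2]
  have hcl : InClass k (Equiv.swap v w * σ) ↔ InClass k σ :=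
    ⟨InClass.of_agree fun x => (hag x).imp Eq.symm And.symm, InClass.of_agree hag⟩
  simp only [Equiv.coe_mulLeft, hcl, altWeight_congr_of_agree p q hag,
    slotWeight_congr_of_agree p q hag, mul_inv_rev, Equiv.Perm.mul_apply, Equiv.swap_inv,
    Equiv.swap_apply_left]

lemma card_mul_sum_altWeight_succ {k N : ℕ} (hk : k < N) :
    ((N - k : ℕ) : R) *
      (∑ σ : Equiv.Perm (Fin N), if InClass k σ then altWeight p q (k + 1) σ else 0) =
    pqInt p q (N - k) * altSum p q N k := by
  have h1 : (∑ σ : Equiv.Perm (Fin N), if InClass k σ then altWeight p q (k + 1) σ else 0) =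
      ∑ σ : Equiv.Perm (Fin N), if InClass k σ then
        altWeight p q k σ * slotWeight p q k σ (σ⁻¹ ⟨k, hk⟩) else 0 := by
    refine Finset.sum_congr rfl fun σ _ => ?_
    split_ifs with hσ
    · exact altWeight_succ p q hσ (by simp)
    · rfl
  have h2 : ((N - k : ℕ) : R) = ∑ v : Fin N, if k ≤ (v : ℕ) then 1 else 0 := by
    rw [← card_filter_le_perm k (1 : Equiv.Perm (Fin N)), Finset.card_filter]
    rw [Nat.cast_sum]
    exact Finset.sum_congr rfl fun x _ => by split_ifs <;> simp_all
  rw [h1, h2, Finset.sum_mul]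
  have h3 : ∀ v : Fin N, (if k ≤ (v : ℕ) then (1 : R) else 0) *
      (∑ σ : Equiv.Perm (Fin N), if InClass k σ then
        altWeight p q k σ * slotWeight p q k σ (σ⁻¹ ⟨k, hk⟩) else 0) =
      ∑ σ : Equiv.Perm (Fin N), (if InClass k σ then altWeight p q k σ else 0) *
        if k ≤ (v : ℕ) then slotWeight p q k σ (σ⁻¹ v) else 0 := by
    intro v
    split_ifs with hv
    · rw [one_mul, sum_slotWeight_inv_apply p q ⟨k, hk⟩ v le_rfl hv]
      simp only [ite_mul, zero_mul]
    · simp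
  rw [Finset.sum_congr rfl fun v _ => h3 v, Finset.sum_comm, altSum, Finset.mul_sum]
  refine Finset.sum_congr rfl fun σ _ => ?_
  rw [← Finset.mul_sum, mul_comm, ← sum_slotWeight p q k σ,
    ← Equiv.sum_comp σ (fun v : Fin N => if k ≤ (v : ℕ) then slotWeight p q k σ (σ⁻¹ v) else 0)]
  simp

end alternating

section peak

variable {N k : ℕ}

/-- Insert the value `k` at position `x + 1` and the value `s` right after it. -/
def insTwo (hk : k < N + 2) (x : Fin N) (s : Fin (N + 1)) (τ : Equiv.Perm (Fin N)) :
    Equiv.Perm (Fin (N + 2)) :=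
  insPerm x.succ.castSucc ⟨k, hk⟩ (insPerm x.succ s τ)

/-- The position in `insTwo hk x s τ` of the entry at position `y` of `τ`. -/
def oldPos (x y : Fin N) : Fin (N + 2) :=
  x.succ.castSucc.succAbove (x.succ.succAbove y)

lemma val_oldPos (x y : Fin N) :
    (oldPos x y : ℕ) = if (y : ℕ) ≤ x then (y : ℕ) else y + 2 := by
  simp only [oldPos, val_succAbove, Fin.val_castSucc, Fin.val_succ]
  split_ifs <;> omega

lemma val_succAbove_succ (x : Fin N) :
    (x.succ.castSucc.succAbove x.succ : ℕ) = x + 2 := by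
  simp

lemma forall_insTwo_pos (x : Fin N) (P : Fin (N + 2) → Prop) :
    (∀ i, P i) ↔ P x.succ.castSucc ∧ P (x.succ.castSucc.succAbove x.succ) ∧
      ∀ y, P (oldPos x y) := by
  rw [forall_fin_succAbove x.succ.castSucc,
    forall_fin_succAbove x.succ (fun i => P (x.succ.castSucc.succAbove i))]
  rfl

variable (hk : k < N + 2) (x : Fin N) (s : Fin (N + 1)) (τ : Equiv.Perm (Fin N))

lemma insTwo_first : (insTwo hk x s τ x.succ.castSucc : ℕ) = k := by
  simp [insTwo]

lemma insTwo_second :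
    (insTwo hk x s τ (x.succ.castSucc.succAbove x.succ) : ℕ) =
      if (s : ℕ) < k then (s : ℕ) else s + 1 := by
  rw [insTwo, insPerm_succAbove, insPerm_self, val_succAbove]

lemma insTwo_oldPos (y : Fin N) : (insTwo hk x s τ (oldPos x y) : ℕ) =
    if (if (τ y : ℕ) < s then (τ y : ℕ) else τ y + 1) < k then
      (if (τ y : ℕ) < s then (τ y : ℕ) else τ y + 1)
    else (if (τ y : ℕ) < s then (τ y : ℕ) else τ y + 1) + 1 := by
  simp [insTwo, oldPos, val_succAbove]

lemma insTwo_oldPos_lt_iff (hs : k ≤ s) (y : Fin N) :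
    (insTwo hk x s τ (oldPos x y) : ℕ) < k ↔ (τ y : ℕ) < k := by
  rw [insTwo_oldPos]
  split_ifs <;> omega

lemma insTwo_oldPos_lt_oldPos_iff (y z : Fin N) :
    (insTwo hk x s τ (oldPos x y) : ℕ) < insTwo hk x s τ (oldPos x z) ↔ (τ y : ℕ) < τ z := by
  rw [insTwo_oldPos, insTwo_oldPos]
  split_ifs <;> omega

lemma insTwo_class_imp
    (h : InClass (k + 1) (insTwo hk x s τ) ∧ ¬ InClass k (insTwo hk x s τ)) :
    k ≤ (s : ℕ) ∧ InClass k τ ∧ k ≤ (τ x : ℕ) := by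
  obtain ⟨⟨halt, hcl⟩, hn⟩ := h
  have hf := insTwo_first hk x s τ
  have hse := insTwo_second hk x s τ
  have ho := insTwo_oldPos hk x s τ
  have hoo := insTwo_oldPos_lt_oldPos_iff hk x s τ
  set σ := insTwo hk x s τ with hσ
  have hx : (x : ℕ) % 2 = 0 := by
    by_contra hx
    refine hn ⟨halt, fun z hz => ?_⟩
    rcases eq_or_ne (σ z : ℕ) k with h1 | h1
    · have : z = x.succ.castSucc := σ.injective (Fin.ext (h1.trans hf.symm))
      rw [this, Fin.val_castSucc, Fin.val_succ]
      omega
    · exact hcl z (by omega)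
  have h1 := (halt x.succ.castSucc (x.succ.castSucc.succAbove x.succ)
    (by rw [val_succAbove_succ, Fin.val_castSucc, Fin.val_succ])).2
    (by rw [Fin.val_castSucc, Fin.val_succ]; omega)
  have h2 := (halt (oldPos x x) x.succ.castSucc
    (by rw [val_oldPos, if_pos le_rfl, Fin.val_castSucc, Fin.val_succ])).1
    (by rw [val_oldPos, if_pos le_rfl]; exact hx)
  rw [hf, hse] at h1
  have hs : k ≤ (s : ℕ) := by
    split_ifs at h1 <;> omega
  have hlt := insTwo_oldPos_lt_iff hk x s τ hs
  rw [← hσ] at hlt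
  have hxk : k ≤ (τ x : ℕ) := by
    have := hlt x
    omega
  have hpar : ∀ y, k ≤ (τ y : ℕ) → (y : ℕ) % 2 = 0 := fun y hy => by
    have h3 := hcl (oldPos x y) (by rw [ho]; split_ifs <;> omega)
    rw [val_oldPos] at h3
    split_ifs at h3 <;> omega
  refine ⟨hs, ⟨fun i j hij => ?_, hpar⟩, hxk⟩
  by_cases hix : i = x
  · subst hix
    have := hpar j
    exact ⟨fun _ => by omega, fun _ => by omega⟩
  · have hne : (i : ℕ) ≠ x := fun h => hix (Fin.ext h)
    have h3 := halt (oldPos x i) (oldPos x j) (by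
      rw [val_oldPos, val_oldPos]
      split_ifs <;> omega)
    rw [hoo, hoo, val_oldPos] at h3
    split_ifs at h3
    · exact h3
    · rwa [Nat.add_mod_right] at h3

lemma insTwo_class_of (hs : k ≤ (s : ℕ)) (hτ : InClass k τ) (hx : k ≤ (τ x : ℕ)) :
    InClass (k + 1) (insTwo hk x s τ) ∧ ¬ InClass k (insTwo hk x s τ) := by
  have hf := insTwo_first hk x s τ
  have hse := insTwo_second hk x s τ
  rw [if_neg (by omega)] at hse
  have hlt := insTwo_oldPos_lt_iff hk x s τ hs
  have ho := insTwo_oldPos hk x s τ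
  have hoo := insTwo_oldPos_lt_oldPos_iff hk x s τ
  obtain ⟨halt, hpar⟩ := hτ
  have hxe := hpar x hx
  have hxv : ((x.succ.castSucc : Fin (N + 2)) : ℕ) = x + 1 := by simp
  have hdv := val_succAbove_succ x
  have hov := val_oldPos x
  have hge : ∀ y, k ≤ (τ y : ℕ) → k < (insTwo hk x s τ (oldPos x y) : ℕ) := fun y hy => by
    rw [ho]
    split_ifs <;> omega
  set σ := insTwo hk x s τ with hσ
  refine ⟨⟨?_, ?_⟩, fun h => ?_⟩
  · rw [IsAlt, forall_insTwo_pos x]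
    simp only [forall_insTwo_pos x (fun j => (j : ℕ) = _ → _), hf, hse, hxv, hdv]
    refine ⟨⟨by omega, by omega, fun y hy => ?_⟩, ⟨by omega, by omega, fun y hy => ?_⟩,
      fun z => ⟨fun hz => ?_, fun hz => ?_, fun y hy => ?_⟩⟩
    · rw [hov] at hy
      split_ifs at hy <;> omega
    · have h1 := hpar y
      have h2 := hlt y
      rw [hov] at hy
      split_ifs at hy <;> omega
    · rw [hov] at hz ⊢
      have hzx : z = x := Fin.ext (by split_ifs at hz <;> omega)
      subst hzx
      have := hge z hx
      rw [if_pos le_rfl]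
      omega
    · rw [hov] at hz
      split_ifs at hz <;> omega
    · rw [hov, hov] at hy
      have h3 := halt z y (by split_ifs at hy <;> omega)
      rw [hoo, hoo, hov]
      split_ifs
      · exact h3
      · rwa [Nat.add_mod_right]
  · rw [forall_insTwo_pos x]
    refine ⟨by omega, by omega, fun y hy => ?_⟩
    have h1 := hpar y
    have h2 := hlt y
    rw [hov]
    split_ifs <;> omega
  · have := h.2 x.succ.castSucc hf.ge
    omega

lemma insTwo_class_iff :
    (InClass (k + 1) (insTwo hk x s τ) ∧ ¬ InClass k (insTwo hk x s τ)) ↔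
      k ≤ (s : ℕ) ∧ InClass k τ ∧ k ≤ (τ x : ℕ) :=
  ⟨insTwo_class_imp hk x s τ, fun h => insTwo_class_of hk x s τ h.1 h.2.1 h.2.2⟩

lemma sum_insTwo_pos {M : Type*} [AddCommMonoid M] (f : Fin (N + 2) → M) :
    ∑ i, f i = f x.succ.castSucc + (f (x.succ.castSucc.succAbove x.succ) +
      ∑ y, f (oldPos x y)) := by
  rw [Fin.sum_univ_succAbove f x.succ.castSucc,
    Fin.sum_univ_succAbove (fun i => f (x.succ.castSucc.succAbove i)) x.succ]
  rfl

lemma prod_insTwo_pos {M : Type*} [CommMonoid M] (f : Fin (N + 2) → M) :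
    ∏ i, f i = f x.succ.castSucc * (f (x.succ.castSucc.succAbove x.succ) *
      ∏ y, f (oldPos x y)) := by
  rw [Fin.prod_univ_succAbove f x.succ.castSucc,
    Fin.prod_univ_succAbove (fun i => f (x.succ.castSucc.succAbove i)) x.succ]
  rfl

lemma neg_one_pow_oldPos (y : Fin N) :
    (-1 : ℤ) ^ (oldPos x y : ℕ) = (-1) ^ (y : ℕ) := by
  rw [val_oldPos]
  split_ifs
  · rfl
  · rw [pow_add]
    simp

lemma oldPos_mod_two (y : Fin N) : (oldPos x y : ℕ) % 2 = (y : ℕ) % 2 := by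
  rw [val_oldPos]
  split_ifs
  · rfl
  · omega

lemma insTwo_ht_oldPos (hs : k ≤ (s : ℕ)) (y : Fin N) (hy : (τ y : ℕ) < k) :
    leftHt (insTwo hk x s τ) (oldPos x y) = leftHt τ y ∧
      rightHt (insTwo hk x s τ) (oldPos x y) = rightHt τ y := by
  have hlt := (insTwo_oldPos_lt_iff hk x s τ hs y).2 hy
  have hse := insTwo_second hk x s τ
  rw [if_neg (by omega)] at hse
  have hyv := val_oldPos x y
  have hord : ∀ z, ((oldPos x z : ℕ) < oldPos x y ↔ (z : ℕ) < y) ∧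
      ((oldPos x y : ℕ) < oldPos x z ↔ (y : ℕ) < z) := fun z => by
    rw [val_oldPos, val_oldPos]
    split_ifs <;> omega
  constructor
  · rw [leftHt, leftHt, sum_insTwo_pos x, oldPos_mod_two, ← add_assoc]
    congr 1
    simp only [neg_one_pow_oldPos, insTwo_oldPos_lt_oldPos_iff, (hord _).1]
    rw [insTwo_first, hse, val_succAbove_succ, Fin.val_castSucc, Fin.val_succ]
    refine add_eq_right.2 ?_
    by_cases hxy : (y : ℕ) ≤ x
    · rw [if_pos hxy] at hyv
      rw [if_neg (by omega), if_neg (by omega), add_zero]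
    · rw [if_neg hxy] at hyv
      rw [if_pos (by omega), if_pos (by omega)]
      ring
  · rw [rightHt, rightHt, sum_insTwo_pos x, oldPos_mod_two, ← add_assoc]
    congr 1
    simp only [neg_one_pow_oldPos, insTwo_oldPos_lt_oldPos_iff, (hord _).2]
    rw [insTwo_first, hse, val_succAbove_succ, Fin.val_castSucc, Fin.val_succ]
    refine add_eq_right.2 ?_
    by_cases hxy : (y : ℕ) ≤ x
    · rw [if_pos hxy] at hyv
      rw [if_pos (by omega), if_pos (by omega)]
      ring
    · rw [if_neg hxy] at hyv
      rw [if_neg (by omega), if_neg (by omega), add_zero]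

lemma insTwo_ht_first (hs : k ≤ (s : ℕ)) (hτ : InClass k τ) (hx : k ≤ (τ x : ℕ)) :
    leftHt (insTwo hk x s τ) x.succ.castSucc =
        (Finset.univ.filter fun y : Fin N => y < x ∧ k ≤ (τ y : ℕ)).card ∧
      rightHt (insTwo hk x s τ) x.succ.castSucc =
        (Finset.univ.filter fun y : Fin N => x < y ∧ k ≤ (τ y : ℕ)).card := by
  have hxe := hτ.2 x hx
  have hse := insTwo_second hk x s τ
  rw [if_neg (by omega)] at hse
  have hgt : ∀ y, k < (insTwo hk x s τ (oldPos x y) : ℕ) ↔ k ≤ (τ y : ℕ) := fun y => by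
    rw [insTwo_oldPos]
    split_ifs <;> omega
  have hpow : ∀ y : Fin N, k ≤ (τ y : ℕ) → (-1 : ℤ) ^ (y : ℕ) = 1 := fun y hy =>
    Even.neg_one_pow (Nat.even_iff.2 (hτ.2 y hy))
  constructor
  · rw [leftHt, sum_insTwo_pos x, insTwo_first, hse, val_succAbove_succ]
    simp only [neg_one_pow_oldPos, hgt]
    simp only [Fin.val_castSucc, Fin.val_succ, val_oldPos]
    rw [if_neg (by omega), if_neg (by omega), if_pos (by omega), zero_add, zero_add,
      Finset.card_filter, ← Finset.sum_erase_add _ _ (Finset.mem_univ x), if_pos ⟨by simp, hx⟩,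
      hpow x hx, add_sub_cancel_right, ← Finset.sum_erase_add univ _ (Finset.mem_univ x),
      if_neg (fun h => lt_irrefl _ h.1), add_zero]
    push_cast
    refine Finset.sum_congr rfl fun y hy => ?_
    have hne : (y : ℕ) ≠ x := fun h => (Finset.mem_erase.1 hy).1 (Fin.ext h)
    by_cases hyk : k ≤ (τ y : ℕ)
    · rw [hpow y hyk]
      refine if_congr ?_ rfl rfl
      rw [Fin.lt_def]
      split_ifs <;> omega
    · rw [if_neg (fun h => hyk h.2), if_neg (fun h => hyk h.2)]
  · rw [rightHt, sum_insTwo_pos x, insTwo_first, hse, val_succAbove_succ]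
    simp only [neg_one_pow_oldPos, hgt]
    simp only [Fin.val_castSucc, Fin.val_succ, val_oldPos]
    rw [if_neg (by omega), if_pos (by omega), if_pos (by omega), zero_add,
      show (-1 : ℤ) ^ ((x : ℕ) + 2) = 1 by rw [pow_add, hpow x hx]; norm_num,
      add_sub_cancel_left, Finset.card_filter]
    push_cast
    refine Finset.sum_congr rfl fun y _ => ?_
    by_cases hyk : k ≤ (τ y : ℕ)
    · rw [hpow y hyk]
      refine if_congr ?_ rfl rfl
      rw [Fin.lt_def]
      split_ifs <;> omega
    · rw [if_neg (fun h => hyk h.2), if_neg (fun h => hyk h.2)]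

variable {R : Type*} [CommRing R] (p q : R)

lemma altWeight_insTwo (hs : k ≤ (s : ℕ)) (hτ : InClass k τ) (hx : k ≤ (τ x : ℕ)) :
    altWeight p q (k + 1) (insTwo hk x s τ) = slotWeight p q k τ x * altWeight p q k τ := by
  have hse := insTwo_second hk x s τ
  rw [if_neg (by omega)] at hse
  rw [altWeight, prod_insTwo_pos x, insTwo_first, hse, if_pos (by omega), if_neg (by omega),
    one_mul, (insTwo_ht_first hk x s τ hs hτ hx).1, (insTwo_ht_first hk x s τ hs hτ hx).2,
    Int.toNat_natCast, Int.toNat_natCast]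
  congr 1
  refine Finset.prod_congr rfl fun y _ => ?_
  by_cases hy : (τ y : ℕ) < k
  · rw [if_pos hy, if_pos (by have := (insTwo_oldPos_lt_iff hk x s τ hs y).2 hy; omega),
      (insTwo_ht_oldPos hk x s τ hs y hy).1, (insTwo_ht_oldPos hk x s τ hs y hy).2]
  · rw [if_neg hy, if_neg]
    rw [insTwo_oldPos]
    split_ifs <;> omega

end peak

section peakSum

variable {R : Type*} [CommRing R] (p q : R)

lemma not_newClass_of_even {k N : ℕ} {σ : Equiv.Perm (Fin N)} {c : Fin N} (hc : (σ c : ℕ) = k)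
    (hpar : (c : ℕ) % 2 = 0) : ¬ (InClass (k + 1) σ ∧ ¬ InClass k σ) := by
  rintro ⟨⟨halt, hcl⟩, hn⟩
  refine hn ⟨halt, fun z hz => ?_⟩
  rcases eq_or_ne (σ z : ℕ) k with h1 | h1
  · rw [σ.injective (Fin.ext (h1.trans hc.symm)), hpar]
  · exact hcl z (by omega)

lemma sum_newClass {N k : ℕ} (hN : N % 2 = 1) (hk : k ≤ N) :
    (∑ σ : Equiv.Perm (Fin (N + 2)),
      if InClass (k + 1) σ ∧ ¬ InClass k σ then altWeight p q (k + 1) σ else 0) =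
    ((N + 1 - k : ℕ) : R) * (pqInt p q (N - k) * altSum p q N k) := by
  have hk' : k < N + 2 := by omega
  have hcard : ((N + 1 - k : ℕ) : R) = ∑ s : Fin (N + 1), if k ≤ (s : ℕ) then 1 else 0 := by
    rw [← card_filter_le_perm k (1 : Equiv.Perm (Fin (N + 1))), Finset.card_filter, Nat.cast_sum]
    exact Finset.sum_congr rfl fun x _ => by split_ifs <;> simp_all
  rw [sum_perm_value ⟨k, hk'⟩, Fin.sum_univ_castSucc, Fin.sum_univ_succ]
  have h0 : ∀ c : Fin (N + 2), (c : ℕ) % 2 = 0 → (∑ τ : Equiv.Perm (Fin (N + 1)),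
      if InClass (k + 1) (insPerm c ⟨k, hk'⟩ τ) ∧ ¬ InClass k (insPerm c ⟨k, hk'⟩ τ) then
        altWeight p q (k + 1) (insPerm c ⟨k, hk'⟩ τ) else 0) = 0 := fun c hc =>
    Finset.sum_eq_zero fun τ _ => if_neg (not_newClass_of_even (c := c) (by simp) hc)
  rw [h0 _ (by simp), h0 _ (by simp; omega), zero_add, add_zero]
  have h1 : ∀ x : Fin N, (∑ τ : Equiv.Perm (Fin (N + 1)),
      if InClass (k + 1) (insPerm x.succ.castSucc ⟨k, hk'⟩ τ) ∧
          ¬ InClass k (insPerm x.succ.castSucc ⟨k, hk'⟩ τ) then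
        altWeight p q (k + 1) (insPerm x.succ.castSucc ⟨k, hk'⟩ τ) else 0) =
      ((N + 1 - k : ℕ) : R) * ∑ τ : Equiv.Perm (Fin N),
        (if k ≤ (τ x : ℕ) then slotWeight p q k τ x else 0) *
          if InClass k τ then altWeight p q k τ else 0 := by
    intro x
    rw [sum_perm_position x.succ, hcard, Finset.sum_mul]
    refine Finset.sum_congr rfl fun s _ => ?_
    rw [Finset.mul_sum]
    refine Finset.sum_congr rfl fun τ _ => ?_
    change (if InClass (k + 1) (insTwo hk' x s τ) ∧ ¬ InClass k (insTwo hk' x s τ) then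
      altWeight p q (k + 1) (insTwo hk' x s τ) else 0) = _
    by_cases h : k ≤ (s : ℕ) ∧ InClass k τ ∧ k ≤ (τ x : ℕ)
    · rw [if_pos ((insTwo_class_iff hk' x s τ).2 h), altWeight_insTwo hk' x s τ p q h.1 h.2.1 h.2.2,
        if_pos h.1, if_pos h.2.1, if_pos h.2.2, one_mul]
    · rw [if_neg (fun h' => h ((insTwo_class_iff hk' x s τ).1 h'))]
      split_ifs <;> simp_all
  rw [Finset.sum_congr rfl fun x _ => h1 x, ← Finset.mul_sum]
  congr 1
  rw [Finset.sum_comm, altSum, Finset.mul_sum]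
  refine Finset.sum_congr rfl fun τ _ => ?_
  rw [← Finset.sum_mul, sum_slotWeight]

lemma altSum_succ {N k : ℕ} (hN : N % 2 = 1) (hk : k ≤ N) :
    ((N + 2 - k : ℕ) : R) * altSum p q (N + 2) (k + 1) =
      pqInt p q (N + 2 - k) * altSum p q (N + 2) k +
      ((N + 2 - k : ℕ) : R) * (((N + 1 - k : ℕ) : R) * (pqInt p q (N - k) * altSum p q N k)) := by
  rw [← card_mul_sum_altWeight_succ p q (show k < N + 2 by omega), ← sum_newClass p q hN hk,
    ← mul_add, ← Finset.sum_add_distrib, altSum]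
  congr 1
  refine Finset.sum_congr rfl fun σ _ => ?_
  have hmono : InClass k σ → InClass (k + 1) σ := fun h => ⟨h.1, fun x hx => h.2 x (by omega)⟩
  by_cases h1 : InClass k σ
  · simp [h1, hmono h1]
  · simp [h1]

end peakSum

section induction

variable {R : Type*} [CommRing R] (p q : R)

lemma altSum_one_zero : altSum p q 1 0 = 1 := by
  have h : InClass 0 (1 : Equiv.Perm (Fin 1)) :=
    ⟨fun i j hij => by omega, fun x _ => by omega⟩
  rw [altSum, Fintype.sum_unique,
    show (default : Equiv.Perm (Fin 1)) = 1 from Subsingleton.elim _ _, if_pos h, altWeight]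
  simp

lemma altSum_zero {N : ℕ} (hN : 2 ≤ N) : altSum p q N 0 = 0 :=
  Finset.sum_eq_zero fun σ _ => if_neg fun h => by
    have := h.2 ⟨1, hN⟩ (Nat.zero_le _)
    simp at this

lemma prod_pqInt_mul_altSum [IsDomain R] [CharZero R] (t h : ℕ) (hh : h ≤ 2 * t) :
    (∏ i ∈ Finset.range (h + 1), pqInt p q (i + 1)) * altSum p q (2 * t + 1) (2 * t - h) =
      (-1) ^ (t + 1) * ((h + 1).factorial : R) * oddSum p q (2 * t + 1) (h + 1) := by
  induction t generalizing h with
  | zero =>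
    obtain rfl : h = 0 := by omega
    simp [altSum_one_zero, oddSum_one, pqInt]
  | succ t ih =>
    induction hh using Nat.decreasingInduction with
    | self =>
      rw [Nat.sub_self, altSum_zero p q (by omega), show 2 * (t + 1) + 1 = 2 * t + 1 + 2 by ring,
        oddSum_self]
      simp
    | of_succ h hlt ihh =>
      have hlow : pqInt p q h * ((∏ i ∈ Finset.range h, pqInt p q (i + 1)) *
          altSum p q (2 * t + 1) (2 * t + 1 - h)) =
          pqInt p q h * ((-1) ^ (t + 1) * (h.factorial : R) * oddSum p q (2 * t + 1) h) := by
        rcases h with _ | h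
        · simp [pqInt]
        · rw [← ih h (by omega), show 2 * t + 1 - (h + 1) = 2 * t - h by omega]
      have hrec := altSum_succ p q (N := 2 * t + 1) (k := 2 * t + 1 - h) (by omega) (by omega)
      rw [show 2 * t + 1 + 2 - (2 * t + 1 - h) = h + 2 by omega,
        show 2 * t + 1 + 1 - (2 * t + 1 - h) = h + 1 by omega,
        show 2 * t + 1 - (2 * t + 1 - h) = h by omega,
        show 2 * t + 1 - h + 1 = 2 * (t + 1) - h by omega,
        show 2 * t + 1 + 2 = 2 * (t + 1) + 1 by ring] at hrec
      have hodd := oddSum_add_two p q (2 * t + 1) h (by omega)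
      rw [show 2 * t + 1 + 2 = 2 * (t + 1) + 1 by ring] at hodd
      rw [show 2 * (t + 1) - (h + 1) = 2 * t + 1 - h by omega, Finset.prod_range_succ,
        Finset.prod_range_succ, Nat.factorial_succ (h + 1), Nat.factorial_succ h] at ihh
      rw [Finset.prod_range_succ, Nat.factorial_succ h]
      have hne : ((h + 2 : ℕ) : R) ≠ 0 := by
        exact_mod_cast (Nat.succ_ne_zero (h + 1))
      refine mul_left_cancel₀ hne ?_
      push_cast at hrec ihh ⊢
      rw [hodd]
      linear_combination (∏ i ∈ Finset.range h, pqInt p q (i + 1)) * pqInt p q (h + 1) * hrec +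
        ihh + ((h : R) + 2) * (h + 1) * pqInt p q (h + 1) * hlow

lemma altSum_eq_oddSum [IsDomain R] [CharZero R] (t : ℕ) :
    altSum p q (2 * t + 1) (2 * t) = (-1) ^ (t + 1) * oddSum p q (2 * t + 1) 1 := by
  have h := prod_pqInt_mul_altSum p q t 0 (Nat.zero_le _)
  simpa [pqInt] using h

end induction

lemma sum_Icc_one_eq_sum_fin {M : Type*} [AddCommMonoid M] (n : ℕ) (f : ℕ → M) :
    ∑ i ∈ Finset.Icc 1 n, f i = ∑ i : Fin n, f (i + 1) := by
  rw [Fin.sum_univ_eq_sum_range (fun i => f (i + 1)) n, Finset.range_eq_Ico, Finset.sum_Ico_add']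
  rfl

lemma card_filter_pairs (n : ℕ) (P : ℕ × ℕ → Prop) [DecidablePred P] :
    ((pairs n).filter P).card =
      ∑ i : Fin n, ∑ j : Fin n, if P ((i : ℕ) + 1, (j : ℕ) + 1) then 1 else 0 := by
  rw [Finset.card_filter, pairs, Finset.sum_product, sum_Icc_one_eq_sum_fin]
  exact Finset.sum_congr rfl fun i _ => sum_Icc_one_eq_sum_fin n _

lemma sum_ite_congr_mem {M : Type*} [AddCommMonoid M] {S T : Finset ℕ} {P Q : ℕ → Prop}
    [DecidablePred P] [DecidablePred Q] (h : ∀ x, (x ∈ S ∧ P x) ↔ (x ∈ T ∧ Q x)) (c : ℕ → M) :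
    (∑ x ∈ S, if P x then c x else 0) = ∑ x ∈ T, if Q x then c x else 0 := by
  rw [← Finset.sum_filter, ← Finset.sum_filter]
  congr 1
  ext x
  simp only [Finset.mem_filter, h x]

lemma signed_sum_left {g : ℕ → ℕ} {s : ℕ} (T : ℕ)
    (halt : ∀ x < T, (x % 2 = 0 → g (x + 1) < g x) ∧ (x % 2 = 1 → g x < g (x + 1)))
    (hne : ∀ x ≤ T, g x ≠ s) :
    (∑ x ∈ Finset.range (T + 1), if s < g x then (-1 : ℤ) ^ x else 0) =
      (∑ x ∈ Finset.range T, if g (x + 1) < s ∧ s < g x then (1 : ℤ) else 0) +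
        if T % 2 = 0 ∧ s < g T then 1 else 0 := by
  induction T with
  | zero => simp
  | succ T ih =>
    rw [Finset.sum_range_succ, ih (fun x hx => halt x (by omega)) (fun x hx => hne x (by omega)),
      Finset.sum_range_succ, add_assoc, add_assoc]
    congr 1
    have h1 := halt T (by omega)
    have h2 := hne T (by omega)
    have h3 := hne (T + 1) le_rfl
    rcases Nat.mod_two_eq_zero_or_one T with h | h
    · rw [Odd.neg_one_pow (Nat.odd_iff.2 (by omega))]
      split_ifs <;> omega
    · rw [Even.neg_one_pow (Nat.even_iff.2 (by omega))]
      split_ifs <;> omega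

lemma signed_sum_right {g : ℕ → ℕ} {s a : ℕ} (d : ℕ)
    (halt : ∀ x < a + d, (x % 2 = 0 → g (x + 1) < g x) ∧ (x % 2 = 1 → g x < g (x + 1)))
    (hne : ∀ x, a ≤ x → x ≤ a + d → g x ≠ s) :
    (∑ x ∈ Finset.Ico a (a + d + 1), if s < g x then (-1 : ℤ) ^ x else 0) =
      (∑ x ∈ Finset.Ico a (a + d), if g x < s ∧ s < g (x + 1) then (1 : ℤ) else 0) +
        (if a % 2 = 0 ∧ s < g a then 1 else 0) -
        if (a + d) % 2 = 1 ∧ s < g (a + d) then 1 else 0 := by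
  induction d with
  | zero =>
    simp only [add_zero, Nat.Ico_succ_singleton, Finset.sum_singleton, Finset.Ico_self,
      Finset.sum_empty, zero_add]
    rcases Nat.mod_two_eq_zero_or_one a with h | h
    · rw [Even.neg_one_pow (Nat.even_iff.2 h)]
      split_ifs <;> omega
    · rw [Odd.neg_one_pow (Nat.odd_iff.2 h)]
      split_ifs <;> omega
  | succ d ih =>
    rw [← add_assoc, Finset.sum_Ico_succ_top (by omega),
      ih (fun x hx => halt x (by omega)) (fun x hx hx' => hne x hx (by omega)),
      Finset.sum_Ico_succ_top (by omega)]
    have h1 := halt (a + d) (by omega)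
    have h2 := hne (a + d) (by omega) (by omega)
    have h3 := hne (a + d + 1) (by omega) (by omega)
    rcases Nat.mod_two_eq_zero_or_one (a + d) with h | h
    · rw [Odd.neg_one_pow (Nat.odd_iff.2 (by omega))]
      split_ifs <;> omega
    · rw [Even.neg_one_pow (Nat.even_iff.2 (by omega))]
      split_ifs <;> omega

section bridge

variable {n : ℕ} (σ : Equiv.Perm (Fin n))

lemma pext_succ (i : Fin n) : pext n σ (i + 1) = σ i + 1 := by
  rw [pext, dif_pos ⟨by omega, by omega⟩]
  simp

lemma pext_zero : pext n σ 0 = 0 := dif_neg (by omega)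

lemma pext_add_one_self : pext n σ (n + 1) = 0 := dif_neg (by omega)

lemma pext_succ_eq_iff {x y : ℕ} (hx : x < n) (hy : y < n) :
    pext n σ (x + 1) = pext n σ (y + 1) ↔ x = y := by
  rw [pext_succ σ ⟨x, hx⟩, pext_succ σ ⟨y, hy⟩, Nat.add_right_cancel_iff, ← Fin.ext_iff,
    σ.injective.eq_iff, Fin.mk.injEq]

lemma isAlt_iff_pext : IsAlt σ ↔ ∀ x, x + 1 < n →
    (x % 2 = 0 → pext n σ (x + 1 + 1) < pext n σ (x + 1)) ∧
      (x % 2 = 1 → pext n σ (x + 1) < pext n σ (x + 1 + 1)) := by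
  constructor
  · intro h x hx
    have := h ⟨x, by omega⟩ ⟨x + 1, hx⟩ rfl
    rw [pext_succ σ ⟨x, by omega⟩, pext_succ σ ⟨x + 1, hx⟩]
    simpa using this
  · intro h i j hij
    have h1 := h i (by omega)
    rw [pext_succ σ i, ← hij, pext_succ σ j] at h1
    omega

lemma wexStat_eq_wexCount : wexStat n σ = wexCount σ := by
  rw [wexStat, Finset.card_filter, sum_Icc_one_eq_sum_fin]
  refine Finset.sum_congr rfl fun i _ => if_congr ?_ rfl rfl
  rw [pext_succ]
  omega

lemma nestStat_eq_pairCount : nestStat n σ = pairCount IsNest σ := by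
  rw [nestStat, card_filter_pairs]
  refine Finset.sum_congr rfl fun i _ => Finset.sum_congr rfl fun j _ => if_congr ?_ rfl rfl
  simp only [pext_succ, IsNest]
  omega

lemma crosStat_eq_pairCount : crosStat n σ = pairCount IsCross σ := by
  rw [crosStat, card_filter_pairs]
  refine Finset.sum_congr rfl fun i _ => Finset.sum_congr rfl fun j _ => if_congr ?_ rfl rfl
  simp only [pext_succ, IsCross]
  omega

/-- Descents to the left of position `j` that straddle the value there. -/
def leftCount (j : ℕ) : ℕ :=
  ∑ x ∈ Finset.range (j - 1),
    if pext n σ (x + 1 + 1) < pext n σ (j + 1) ∧ pext n σ (j + 1) < pext n σ (x + 1) then 1 else 0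

/-- Ascents to the right of position `j` that straddle the value there. -/
def rightCount (j : ℕ) : ℕ :=
  ∑ x ∈ Finset.Ico (j + 1) (n - 1),
    if pext n σ (x + 1) < pext n σ (j + 1) ∧ pext n σ (j + 1) < pext n σ (x + 1 + 1) then 1 else 0

lemma lesStat_eq_sum : lesStat n σ = ∑ j : Fin n, leftCount σ j := by
  rw [lesStat, card_filter_pairs, Finset.sum_comm]
  refine Finset.sum_congr rfl fun j _ => ?_
  have hj := j.2
  simp only [Nat.add_sub_cancel]
  rw [Fin.sum_univ_eq_sum_range (fun i => if 2 ≤ i + 1 ∧ i + 1 < (j : ℕ) + 1 ∧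
    pext n σ (i + 1) < pext n σ (j + 1) ∧ pext n σ (j + 1) < pext n σ i then 1 else 0) n]
  rw [sum_ite_congr_mem (T := Finset.range (j - 1 + 1)) (Q := fun i => 1 ≤ i ∧ i < (j : ℕ) ∧
    pext n σ (i + 1) < pext n σ (j + 1) ∧ pext n σ (j + 1) < pext n σ i)
    (fun i => by simp only [Finset.mem_range]; omega) (fun _ => 1), Finset.sum_range_succ',
    if_neg (by omega), add_zero, leftCount]
  refine Finset.sum_congr rfl fun i hi => if_congr ?_ rfl rfl
  have := Finset.mem_range.1 hi
  omega

lemma resStat_eq_sum : resStat n σ = ∑ j : Fin n, rightCount σ j := by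
  rw [resStat, card_filter_pairs]
  refine Finset.sum_congr rfl fun j _ => ?_
  rw [Fin.sum_univ_eq_sum_range (fun x => if (j : ℕ) + 1 < x + 1 ∧ x + 1 ≤ n - 1 ∧
    pext n σ (x + 1) < pext n σ (j + 1) ∧ pext n σ (j + 1) < pext n σ (x + 1 + 1) then 1 else 0) n]
  exact sum_ite_congr_mem (fun x => by simp only [Finset.mem_range, Finset.mem_Ico]; omega) _

variable {σ}

lemma leftHt_eq_leftCount (hσ : IsAlt σ) (j : Fin n) : leftHt σ j = leftCount σ j := by
  have halt := (isAlt_iff_pext σ).1 hσ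
  have hsum : (∑ x : Fin n, if (x : ℕ) < j ∧ (σ j : ℕ) < σ x then (-1 : ℤ) ^ (x : ℕ) else 0) =
      ∑ x ∈ Finset.range j, if pext n σ (j + 1) < pext n σ (x + 1) then (-1 : ℤ) ^ x else 0 := by
    rw [← sum_ite_congr_mem (S := Finset.range n)
      (P := fun x => x < (j : ℕ) ∧ pext n σ (j + 1) < pext n σ (x + 1))
      (Q := fun x => pext n σ (j + 1) < pext n σ (x + 1))
      (fun x => by simp only [Finset.mem_range]; omega) (fun x => (-1 : ℤ) ^ x),
      ← Fin.sum_univ_eq_sum_range (fun x => if x < (j : ℕ) ∧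
        pext n σ (j + 1) < pext n σ (x + 1) then (-1 : ℤ) ^ x else 0) n]
    refine Finset.sum_congr rfl fun x _ => if_congr ?_ rfl rfl
    rw [pext_succ, pext_succ]
    omega
  have hj := j.2
  rw [leftHt, hsum, leftCount]
  rcases hT : (j : ℕ) with _ | T
  · simp
  · rw [hT] at hj
    have h1 := halt T hj
    rw [signed_sum_left (g := fun x => pext n σ (x + 1)) T (fun x hx => halt x (by omega))
      (fun x hx => by rw [Ne, pext_succ_eq_iff σ (by omega) hj]; omega)]
    push_cast
    rw [add_sub_assoc, add_eq_left]
    split_ifs <;> omega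

lemma rightHt_eq_rightCount (hn : n % 2 = 1) (hσ : IsAlt σ) (j : Fin n) :
    rightHt σ j = rightCount σ j := by
  have halt := (isAlt_iff_pext σ).1 hσ
  have hsum : (∑ x : Fin n, if (j : ℕ) < x ∧ (σ j : ℕ) < σ x then (-1 : ℤ) ^ (x : ℕ) else 0) =
      ∑ x ∈ Finset.Ico ((j : ℕ) + 1) n,
        if pext n σ (j + 1) < pext n σ (x + 1) then (-1 : ℤ) ^ x else 0 := by
    rw [← sum_ite_congr_mem (S := Finset.range n)
      (P := fun x => (j : ℕ) < x ∧ pext n σ (j + 1) < pext n σ (x + 1))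
      (Q := fun x => pext n σ (j + 1) < pext n σ (x + 1))
      (fun x => by simp only [Finset.mem_range, Finset.mem_Ico]; omega) (fun x => (-1 : ℤ) ^ x),
      ← Fin.sum_univ_eq_sum_range (fun x => if (j : ℕ) < x ∧
        pext n σ (j + 1) < pext n σ (x + 1) then (-1 : ℤ) ^ x else 0) n]
    refine Finset.sum_congr rfl fun x _ => if_congr ?_ rfl rfl
    rw [pext_succ, pext_succ]
    omega
  have hj := j.2
  rw [rightHt, hsum, rightCount]
  rcases Nat.lt_or_ge ((j : ℕ) + 1) n with h | h
  · obtain ⟨d, hd⟩ : ∃ d, n - 1 = (j : ℕ) + 1 + d := ⟨n - 1 - (j + 1), by omega⟩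
    have h1 := halt j h
    have hd' : Finset.Ico ((j : ℕ) + 1) n = Finset.Ico ((j : ℕ) + 1) ((j : ℕ) + 1 + d + 1) := by
      congr 1
      omega
    rw [hd', hd, signed_sum_right (g := fun x => pext n σ (x + 1)) d
      (fun x hx => halt x (by omega))
      (fun x hx hx' => by rw [Ne, pext_succ_eq_iff σ (by omega) hj]; omega)]
    push_cast
    rw [if_neg (c := ((j : ℕ) + 1 + d) % 2 = 1 ∧ _) (by omega), sub_zero, add_sub_assoc,
      add_eq_left]
    split_ifs <;> omega
  · rw [Finset.Ico_eq_empty (by omega), Finset.Ico_eq_empty (by omega), if_neg (by omega)]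
    simp

lemma pow_resStat_mul_pow_lesStat {R : Type*} [CommRing R] (p q : R) (hn : n % 2 = 1)
    (hσ : IsAlt σ) :
    p ^ resStat n σ * q ^ lesStat n σ = altWeight p q (n - 1) σ := by
  rw [resStat_eq_sum, lesStat_eq_sum, ← Finset.prod_pow_eq_pow_sum, ← Finset.prod_pow_eq_pow_sum,
    ← Finset.prod_mul_distrib, altWeight]
  refine Finset.prod_congr rfl fun j _ => ?_
  have hmax : ∀ x, pext n σ x ≤ n := fun x => by
    rw [pext]
    split_ifs <;> omega
  split_ifs with h
  · rw [leftHt_eq_leftCount hσ, rightHt_eq_rightCount hn hσ, Int.toNat_natCast, Int.toNat_natCast]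
  · have hj : ∀ x, ¬ pext n σ (j + 1) < pext n σ x := fun x => by
      have := hmax x
      rw [pext_succ]
      omega
    rw [leftCount, rightCount, Finset.sum_eq_zero fun x _ => if_neg fun h => hj _ h.2,
      Finset.sum_eq_zero fun x _ => if_neg fun h => hj _ h.2]
    simp

lemma inClass_iff_isAlt (hn : n % 2 = 1) : InClass (n - 1) σ ↔ IsAlt σ := by
  refine ⟨fun h => h.1, fun h => ⟨h, fun x hx => ?_⟩⟩
  by_contra hpar
  have h1 := (h x ⟨x + 1, by omega⟩ rfl).2 (by omega)
  omega

lemma two_mul_mem_of_card_eq {m : ℕ} {S : Finset ℕ} (h1 : ∀ i ∈ S, 2 ≤ i ∧ i ≤ 2 * m)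
    (h2 : ∀ i ∈ S, i + 1 ∉ S) (hcard : S.card = m) (t : ℕ) (ht : 1 ≤ t) (htm : t ≤ m) :
    2 * t ∈ S := by
  have himg : S.image (fun i => (i + 1) / 2) = Finset.Icc 1 m := by
    refine Finset.eq_of_subset_of_card_le ?_ ?_
    · intro t ht
      obtain ⟨i, hi, rfl⟩ := Finset.mem_image.1 ht
      have := h1 i hi
      rw [Finset.mem_Icc]
      omega
    · rw [Finset.card_image_of_injOn, hcard, Nat.card_Icc]
      · omega
      · intro i hi j hj hij
        by_contra hne
        have hij' : (i + 1) / 2 = (j + 1) / 2 := hij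
        rcases (by omega : j = i + 1 ∨ i = j + 1) with h | h
        · exact h2 i hi (h ▸ hj)
        · exact h2 j hj (h ▸ hi)
  have hmem : ∀ t, 1 ≤ t → t ≤ m → 2 * t ∉ S → 2 * t - 1 ∈ S := fun t ht htm hnot => by
    have : t ∈ S.image (fun i => (i + 1) / 2) := by rw [himg, Finset.mem_Icc]; exact ⟨ht, htm⟩
    obtain ⟨i, hi, hit⟩ := Finset.mem_image.1 this
    have hit' : (i + 1) / 2 = t := hit
    rcases (by omega : i = 2 * t ∨ i = 2 * t - 1) with h | h
    · exact absurd (h ▸ hi) hnot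
    · exact h ▸ hi
  induction t, ht using Nat.le_induction with
  | base =>
    by_contra hnot
    have := h1 _ (hmem 1 le_rfl htm hnot)
    omega
  | succ t ht ih =>
    by_contra hnot
    have h3 := hmem (t + 1) (by omega) htm hnot
    rw [show 2 * (t + 1) - 1 = 2 * t + 1 by omega] at h3
    exact h2 _ (ih (by omega)) h3

lemma valleyStar_ddStar_iff (m : ℕ) (hn : n = 2 * m + 1) :
    (valleyStar n σ = m ∧ ddStar n σ = 0) ↔ IsAlt σ := by
  have hz := pext_zero σ
  have hl := pext_add_one_self σ
  rw [isAlt_iff_pext, valleyStar, ddStar, Finset.card_eq_zero, Finset.filter_eq_empty_iff]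
  constructor
  · rintro ⟨hv, -⟩ x hx
    have key := two_mul_mem_of_card_eq (m := m) (fun i hi => ?_) (fun i hi hi' => ?_) hv
    · constructor <;> intro hpar
      · have h1 := key ((x + 2) / 2) (by omega) (by omega)
        rw [show 2 * ((x + 2) / 2) = x + 1 + 1 by omega, Finset.mem_filter] at h1
        exact h1.2.1
      · have h1 := key ((x + 1) / 2) (by omega) (by omega)
        rw [show 2 * ((x + 1) / 2) = x + 1 by omega, Finset.mem_filter] at h1
        exact h1.2.2
    · rw [Finset.mem_filter, Finset.mem_Icc] at hi
      have h1 : i ≠ 1 := by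
        rintro rfl
        simp [hz] at hi
      have h2 : i ≠ n := by
        rintro rfl
        omega
      omega
    · rw [Finset.mem_filter] at hi hi'
      have h1 := hi'.2.1
      rw [Nat.add_sub_cancel] at h1
      omega
  · intro halt
    have hodd : ∀ i ∈ Finset.Icc 1 n, i % 2 = 1 → ¬ pext n σ i < pext n σ (i - 1) := by
      intro i hi hpar
      rw [Finset.mem_Icc] at hi
      rcases (by omega : i = 1 ∨ 3 ≤ i) with rfl | h3
      · simp [hz]
      · have h1 := (halt (i - 2) (by omega)).2 (by omega)
        rw [show i - 2 + 1 = i - 1 by omega, show i - 1 + 1 = i by omega] at h1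
        omega
    have heven : ∀ i ∈ Finset.Icc 1 n, i % 2 = 0 →
        pext n σ i < pext n σ (i - 1) ∧ pext n σ i < pext n σ (i + 1) := by
      intro i hi hpar
      rw [Finset.mem_Icc] at hi
      have h1 := (halt (i - 2) (by omega)).1 (by omega)
      have h2 := (halt (i - 1) (by omega)).2 (by omega)
      rw [show i - 2 + 1 = i - 1 by omega, show i - 1 + 1 = i by omega] at h1
      rw [show i - 1 + 1 = i by omega] at h2
      exact ⟨h1, h2⟩
    constructor
    · have himg : (Finset.Icc 1 n).filter (fun i => pext n σ i < pext n σ (i - 1) ∧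
          pext n σ i < pext n σ (i + 1)) = (Finset.Icc 1 m).image (2 * ·) := by
        ext i
        rw [Finset.mem_filter, Finset.mem_image]
        constructor
        · rintro ⟨hi, hv⟩
          have h1 := hodd i hi
          rw [Finset.mem_Icc] at hi
          refine ⟨i / 2, ?_, ?_⟩
          · rw [Finset.mem_Icc]
            omega
          · by_contra h2
            exact h1 (by omega) hv.1
        · rintro ⟨t, ht, rfl⟩
          rw [Finset.mem_Icc] at ht
          have hi : 2 * t ∈ Finset.Icc 1 n := by
            rw [Finset.mem_Icc]
            omega
          exact ⟨hi, heven _ hi (by omega)⟩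
      rw [himg, Finset.card_image_of_injective _ (fun a b h => by simpa using h), Nat.card_Icc]
      omega
    · intro i hi hdd
      rcases Nat.mod_two_eq_zero_or_one i with h | h
      · have := heven i hi h
        omega
      · exact hodd i hi h hdd.2

end bridge

open MvPolynomial in
theorem statement9 (n : ℕ) (hn : 1 ≤ n) :
    (Even n →
      (∑ σ : Equiv.Perm (Fin n),
        (-1 : MvPolynomial (Fin 2) ℤ) ^ wexStat n σ *
          X 0 ^ nestStat n σ * X 1 ^ crosStat n σ) = 0) ∧
    (Odd n →
      (∑ σ : Equiv.Perm (Fin n),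
        (-1 : MvPolynomial (Fin 2) ℤ) ^ wexStat n σ *
          X 0 ^ nestStat n σ * X 1 ^ crosStat n σ) =
      (-1 : MvPolynomial (Fin 2) ℤ) ^ ((n + 1) / 2) *
        ∑ σ ∈ Finset.univ.filter
            (fun σ : Equiv.Perm (Fin n) =>
              valleyStar n σ = (n - 1) / 2 ∧ ddStar n σ = 0),
          (X 0 : MvPolynomial (Fin 2) ℤ) ^ resStat n σ * X 1 ^ lesStat n σ) := by
  have hsum : (∑ σ : Equiv.Perm (Fin n), (-1 : MvPolynomial (Fin 2) ℤ) ^ wexStat n σ *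
      X 0 ^ nestStat n σ * X 1 ^ crosStat n σ) = oddSum (X 0) (X 1) n 1 := by
    rw [← sum_cycWeight]
    refine Finset.sum_congr rfl fun σ _ => ?_
    rw [wexStat_eq_wexCount, nestStat_eq_pairCount, crosStat_eq_pairCount, cycWeight]
  rw [hsum]
  refine ⟨fun h => ?_, fun h => ?_⟩
  · obtain ⟨N, rfl⟩ := h
    rw [← two_mul]
    exact oddSum_even _ _ N 1 le_rfl (by omega)
  · obtain ⟨t, ht⟩ := h
    have hpar : n % 2 = 1 := by omega
    rw [show (n + 1) / 2 = t + 1 by omega, show (n - 1) / 2 = t by omega, Finset.sum_filter]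
    have halt : (∑ σ : Equiv.Perm (Fin n), if valleyStar n σ = t ∧ ddStar n σ = 0 then
        (X 0 : MvPolynomial (Fin 2) ℤ) ^ resStat n σ * X 1 ^ lesStat n σ else 0) =
        altSum (X 0) (X 1) n (n - 1) := by
      refine Finset.sum_congr rfl fun σ _ => ?_
      by_cases hσ : IsAlt σ
      · rw [if_pos ((valleyStar_ddStar_iff t ht).2 hσ), if_pos ((inClass_iff_isAlt hpar).2 hσ)]
        exact pow_resStat_mul_pow_lesStat _ _ hpar hσ
      · rw [if_neg (mt (valleyStar_ddStar_iff t ht).1 hσ),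
          if_neg (mt (inClass_iff_isAlt hpar).1 hσ)]
    rw [halt, show n - 1 = 2 * t by omega, ht, altSum_eq_oddSum, ← mul_assoc, ← mul_pow]
    simp

end SZpaper
end
end

section
/- For every integer n ≥ 1, the following identity holds in ℤ[β,t]: Σ_{σ∈D_n} β^{cyc σ} t^{exc σ} = Σ_{k=0}^{⌊n/2⌋} c_{n,k}(β) · t^k · (1+t)^{n−2k}, where c_{n,k}(β) = Σ_{σ∈D_n(k)} β^{cyc σ} and D_n(k) is the set of derangements of [n] with exactly k cyclic valleys and no double drops. -/
open scoped Classical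
open Finset

noncomputable section

namespace SZpaper

open MvPolynomial in
/-- `c_{n,k}(β)` (with `β = X 0`), as an element of `ℤ[β,t]`: the sum of
`β^{cyc σ}` over derangements of `[n]` with exactly `k` cyclic valleys and
no double drops. -/
def cPoly (n k : ℕ) : MvPolynomial (Fin 2) ℤ :=
  ∑ σ ∈ Finset.univ.filter
      (fun σ : Equiv.Perm (Fin n) =>
        fixStat n σ = 0 ∧ cvalleyStat n σ = k ∧ cddStat n σ = 0),
    X 0 ^ cycStat n σ

section Cycles

open Equiv Equiv.Perm

theorem card_cycleType_swap_mul {α : Type*} [Fintype α] [DecidableEq α] (g : Perm α) {x : α}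
    (hx : g x ≠ x) :
    Multiset.card (swap x (g x) * g).cycleType + g.support.card =
      Multiset.card g.cycleType + (swap x (g x) * g).support.card + 1 := by
  have hc : (g.cycleOf x).IsCycle := isCycle_cycleOf g hx
  have hcx : g.cycleOf x x = g x := cycleOf_apply_self g x
  have hmem : g.cycleOf x ∈ g.cycleFactorsFinset := by
    rw [cycleOf_mem_cycleFactorsFinset_iff]; exact mem_support.2 hx
  have hd := (disjoint_mul_inv_of_mem_cycleFactorsFinset hmem).symm
  have hg : g = g.cycleOf x * (g * (g.cycleOf x)⁻¹) := by
    rw [hd.commute.eq]; simp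
  generalize g.cycleOf x = c at *
  generalize g * c⁻¹ = r at *
  have hcx' : c x ≠ x := hcx ▸ hx
  have hs : swap x (g x) * g = (swap x (c x) * c) * r := by
    rw [← hcx, mul_assoc, ← hg]
  have hsub : (swap x (c x) * c).support ⊆ c.support := by
    intro y hy
    exact mem_support.2 (ne_and_ne_of_swap_mul_apply_ne_self (mem_support.1 hy)).1
  have hd' : Perm.Disjoint (swap x (c x) * c) r := hd.mono hsub subset_rfl
  rw [hs, hd'.cycleType_mul, hd'.card_support_mul]
  rw [hg, hd.cycleType_mul, hd.card_support_mul]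
  have hcard : Multiset.card (swap x (c x) * c).cycleType + c.support.card =
      Multiset.card c.cycleType + (swap x (c x) * c).support.card + 1 := by
    by_cases hxx : c (c x) = x
    · rw [hc.eq_swap_of_apply_apply_eq_self hcx' hxx]
      simp [card_support_swap hcx'.symm, (isCycle_swap hcx'.symm).cycleType]
    · rw [(hc.swap_mul hcx' hxx).cycleType, hc.cycleType, support_swap_mul_eq _ _ hxx,
        Finset.sdiff_singleton_eq_erase, Finset.card_erase_of_mem (mem_support.2 hcx')]
      have : 0 < c.support.card := Finset.card_pos.2 ⟨x, mem_support.2 hcx'⟩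
      simp only [Multiset.card_singleton]
      omega
  simp only [Multiset.card_add]
  omega

theorem cycStat_add_card_support {n : ℕ} (σ : Perm (Fin n)) :
    cycStat n σ + σ.support.card = Multiset.card σ.cycleType + n := by
  have h := Finset.card_filter_add_card_filter_not (s := (univ : Finset (Fin n))) (fun x => σ x = x)
  have h2 : σ.support = univ.filter fun x => ¬ σ x = x := by ext; simp
  rw [cycStat, h2]
  simp only [Finset.card_univ, Fintype.card_fin] at h
  omega

theorem decomposeFin_symm_zero_eq_extendDomain {n : ℕ} (e : Perm (Fin n)) :
    decomposeFin.symm (0, e) = e.extendDomain (finSuccAboveEquiv (0 : Fin (n + 1))) := by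
  ext x
  refine Fin.cases ?_ (fun i => ?_) x
  · rw [extendDomain_apply_not_subtype _ _ (by simp)]; simp
  · have := extendDomain_apply_image e (finSuccAboveEquiv (0 : Fin (n + 1))) i
    simp [finSuccAboveEquiv] at this
    simp [this, finSuccAboveEquiv]

theorem cycStat_decomposeFin_symm_zero {n : ℕ} (e : Perm (Fin n)) :
    cycStat (n + 1) (decomposeFin.symm (0, e)) = cycStat n e + 1 := by
  have h1 := cycStat_add_card_support (n := n + 1) (decomposeFin.symm (0, e))
  have h2 := cycStat_add_card_support e
  rw [decomposeFin_symm_zero_eq_extendDomain, cycleType_extendDomain,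
    card_support_extend_domain] at h1
  rw [decomposeFin_symm_zero_eq_extendDomain]
  omega

theorem cycStat_decomposeFin_symm_succ {n : ℕ} (j : Fin n) (e : Perm (Fin n)) :
    cycStat (n + 1) (decomposeFin.symm (j.succ, e)) = cycStat n e := by
  have h0 := cycStat_decomposeFin_symm_zero e
  have h := card_cycleType_swap_mul (decomposeFin.symm (j.succ, e)) (x := 0) (by simp)
  have hs : swap 0 (decomposeFin.symm (j.succ, e) 0) * decomposeFin.symm (j.succ, e) =
      decomposeFin.symm (0, e) := by
    ext x
    refine Fin.cases ?_ (fun i => ?_) x <;> simp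
  rw [hs] at h
  have h1 := cycStat_add_card_support (n := n + 1) (decomposeFin.symm (j.succ, e))
  have h2 := cycStat_add_card_support (n := n + 1) (decomposeFin.symm (0, e))
  omega

end Cycles

section Recursion

open Equiv Equiv.Perm

theorem decomposeFin_symm_succ_apply_succ {n : ℕ} (j : Fin n) (e : Perm (Fin n)) (x : Fin n) :
    decomposeFin.symm (j.succ, e) x.succ = if e x = j then 0 else (e x).succ := by
  rw [decomposeFin_symm_apply_succ, swap_apply_def]
  simp [Fin.succ_ne_zero]

theorem decomposeFin_symm_succ_inv_apply_zero {n : ℕ} (j : Fin n) (e : Perm (Fin n)) :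
    (decomposeFin.symm (j.succ, e))⁻¹ 0 = (e⁻¹ j).succ := by
  rw [inv_eq_iff_eq, decomposeFin_symm_succ_apply_succ]
  simp

theorem decomposeFin_symm_succ_inv_apply_succ {n : ℕ} (j : Fin n) (e : Perm (Fin n)) (x : Fin n) :
    (decomposeFin.symm (j.succ, e))⁻¹ x.succ = if x = j then 0 else (e⁻¹ x).succ := by
  rw [inv_eq_iff_eq]
  split_ifs with h
  · simp [h]
  · rw [decomposeFin_symm_succ_apply_succ]
    simp [h]

theorem decomposeFin_symm_zero_inv_apply_succ {n : ℕ} (e : Perm (Fin n)) (x : Fin n) :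
    (decomposeFin.symm (0, e))⁻¹ x.succ = (e⁻¹ x).succ := by
  rw [inv_eq_iff_eq]
  simp

/-- The position of `x` in its cycle: `1` for a fixed point, `2` for a cyclic valley, `3` for a
cyclic peak, `4` for a double excedance and `5` for a double drop. -/
def kind {n : ℕ} (σ : Perm (Fin n)) (x : Fin n) : Fin 6 :=
  if σ x = x then 1
  else if x < σ⁻¹ x then (if x < σ x then 2 else 5)
  else (if x < σ x then 4 else 3)

theorem kind_decomposeFin_symm_zero_zero {n : ℕ} (e : Perm (Fin n)) :
    kind (n := n + 1) (decomposeFin.symm (0, e)) 0 = 1 := by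
  simp [kind]

theorem kind_decomposeFin_symm_zero_succ {n : ℕ} (e : Perm (Fin n)) (x : Fin n) :
    kind (n := n + 1) (decomposeFin.symm (0, e)) x.succ = kind e x := by
  have h := decomposeFin_symm_zero_inv_apply_succ e x
  have h' : decomposeFin.symm (0, e) x.succ = (e x).succ := by simp
  simp only [kind]
  rw [h, h']
  simp only [Fin.succ_inj, Fin.succ_lt_succ_iff]

theorem kind_decomposeFin_symm_succ_zero {n : ℕ} (j : Fin n) (e : Perm (Fin n)) :
    kind (n := n + 1) (decomposeFin.symm (j.succ, e)) 0 = 2 := by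
  have h := decomposeFin_symm_succ_inv_apply_zero j e
  have h' : decomposeFin.symm (j.succ, e) 0 = j.succ := by simp
  simp only [kind]
  rw [h, h']
  simp [Fin.succ_ne_zero]

theorem kind_decomposeFin_symm_succ_succ {n : ℕ} (j : Fin n) (e : Perm (Fin n)) (x : Fin n) :
    kind (n := n + 1) (decomposeFin.symm (j.succ, e)) x.succ =
      if e j = j ∧ x = j then 3
      else if e⁻¹ j < j ∧ x = e⁻¹ j then (if x < e⁻¹ x then 5 else 3)
      else if j < e⁻¹ j ∧ x = j then (if x < e x then 4 else 3)
      else kind e x := by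
  have h := decomposeFin_symm_succ_inv_apply_succ j e x
  have h' := decomposeFin_symm_succ_apply_succ j e x
  have hx : x = e⁻¹ j ↔ e x = j := by rw [eq_comm, inv_eq_iff_eq, eq_comm]
  have hj : e j = j ↔ e⁻¹ j = j := by rw [inv_eq_iff_eq, eq_comm]
  have hxx : e x = x ↔ e⁻¹ x = x := by rw [inv_eq_iff_eq, eq_comm]
  simp only [kind]
  rw [h, h']
  by_cases h1 : x = j
  · subst h1
    by_cases h2 : e x = x
    · simp [h2, (Fin.succ_ne_zero _).symm]
    · have h3 : e⁻¹ x ≠ x := fun h => h2 (hxx.2 h)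
      have h4 : ¬ x = e⁻¹ x := fun h => h3 h.symm
      simp only [h2, h4, if_true, if_false, and_false, and_true, Fin.succ_inj,
        Fin.succ_lt_succ_iff, Fin.not_lt_zero]
      by_cases h5 : x < e⁻¹ x <;> simp only [h5, if_true, if_false]
  · by_cases h2 : e x = j
    · have h3 : x = e⁻¹ j := hx.2 h2
      have h5 : e⁻¹ j ≠ j := fun h => h1 (h3.trans h)
      have h6 : e x ≠ x := fun h => h1 (h.symm.trans h2)
      have h7 : ¬ e j = j := fun h => h5 (hj.1 h)
      rw [← h3]
      simp only [h1, h2, h7, if_true, if_false, and_false, and_true,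
        Fin.succ_lt_succ_iff, Fin.not_lt_zero, (Fin.succ_ne_zero x).symm, ne_comm.1 h1]
      rcases lt_or_ge x j with h8 | h8
      · simp [h8]
      · simp [not_lt.2 h8]
    · have h3 : ¬ x = e⁻¹ j := fun h => h2 (hx.1 h)
      simp only [h1, h2, h3, if_false, and_false, Fin.succ_inj, Fin.succ_lt_succ_iff]

open MvPolynomial

/-- The monomial recording the number of cycles of `σ` and the kinds of all its points. -/
def kindMonomial {n : ℕ} (σ : Perm (Fin n)) : MvPolynomial (Fin 6) ℤ :=
  X 0 ^ cycStat n σ * ∏ x, X (kind σ x)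

/-- The generating polynomial of the kind monomials. -/
def kindPoly (n : ℕ) : MvPolynomial (Fin 6) ℤ := ∑ σ : Perm (Fin n), kindMonomial σ

/-- The derivation describing the insertion of a new smallest point into a cycle. -/
def insertion : Derivation ℤ (MvPolynomial (Fin 6) ℤ) (MvPolynomial (Fin 6) ℤ) :=
  mkDerivation ℤ ![0, X 2 * X 3, X 2 * (X 4 + X 5), 0, X 2 * X 3, X 2 * X 3]

theorem derivation_prod {R A ι : Type*} [DecidableEq ι] [CommRing R] [CommRing A]
    [Algebra R A] (D : Derivation R A A) (s : Finset ι) (f : ι → A) :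
    D (∏ i ∈ s, f i) = ∑ i ∈ s, D (f i) * ∏ j ∈ s.erase i, f j := by
  induction s using Finset.induction_on with
  | empty => simp
  | insert a s ha ih =>
    rw [Finset.prod_insert ha, D.leibniz, ih, Finset.sum_insert ha, Finset.erase_insert ha,
      smul_eq_mul, smul_eq_mul, mul_comm (D (f a)), add_comm, Finset.mul_sum]
    congr 1
    refine Finset.sum_congr rfl fun i hi => ?_
    have hai : a ≠ i := fun h => ha (h ▸ hi)
    rw [Finset.erase_insert_of_ne hai, Finset.prod_insert (by simp [ha])]
    ring

theorem kindMonomial_decomposeFin_symm_zero {n : ℕ} (e : Perm (Fin n)) :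
    kindMonomial (n := n + 1) (decomposeFin.symm (0, e)) = X 0 * X 1 * kindMonomial e := by
  simp only [kindMonomial, Fin.prod_univ_succ, cycStat_decomposeFin_symm_zero,
    kind_decomposeFin_symm_zero_zero, kind_decomposeFin_symm_zero_succ]
  ring

theorem prod_kind_decomposeFin_symm_succ {n : ℕ} (j : Fin n) (e : Perm (Fin n)) :
    ∏ x : Fin n, (X (kind (n := n + 1) (decomposeFin.symm (j.succ, e)) x.succ) :
        MvPolynomial (Fin 6) ℤ) =
      (if e j = j then X 3 * ∏ x ∈ univ.erase j, X (kind e x) else 0) +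
      (if e⁻¹ j < j then (if e⁻¹ j < e⁻¹ (e⁻¹ j) then X 5 else X 3) *
        ∏ x ∈ univ.erase (e⁻¹ j), X (kind e x) else 0) +
      (if j < e⁻¹ j then (if j < e j then X 4 else X 3) *
        ∏ x ∈ univ.erase j, X (kind e x) else 0) := by
  have hj : e j = j ↔ e⁻¹ j = j := by rw [inv_eq_iff_eq, eq_comm]
  simp only [kind_decomposeFin_symm_succ_succ]
  rcases lt_trichotomy (e⁻¹ j) j with h | h | h
  · have h1 : ¬ e j = j := fun h' => h.ne (hj.1 h')
    simp only [h, h1, h.not_gt, if_false, false_and, true_and, if_true, zero_add, add_zero]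
    rw [← Finset.mul_prod_erase _ _ (mem_univ (e⁻¹ j))]
    congr 1
    · rw [if_pos rfl]; split_ifs <;> rfl
    · refine Finset.prod_congr rfl fun x hx => ?_
      rw [if_neg (Finset.ne_of_mem_erase hx)]
  · have h1 : e j = j := hj.2 h
    simp only [h, h1, lt_irrefl, if_false, false_and, true_and, if_true, add_zero]
    rw [← Finset.mul_prod_erase _ _ (mem_univ j)]
    congr 1
    · rw [if_pos rfl]
    · refine Finset.prod_congr rfl fun x hx => ?_
      rw [if_neg (Finset.ne_of_mem_erase hx)]
  · have h1 : ¬ e j = j := fun h' => h.ne' (hj.1 h')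
    simp only [h, h1, h.not_gt, if_false, false_and, true_and, if_true, zero_add]
    rw [← Finset.mul_prod_erase _ _ (mem_univ j)]
    congr 1
    · rw [if_pos rfl]; split_ifs <;> rfl
    · refine Finset.prod_congr rfl fun x hx => ?_
      rw [if_neg (Finset.ne_of_mem_erase hx)]

theorem insertion_X_kind {n : ℕ} (e : Perm (Fin n)) (x : Fin n) :
    insertion (X (kind e x)) = X 2 *
      ((if e x = x then X 3 else 0) + (if x < e x then (if x < e⁻¹ x then X 5 else X 3) else 0) +
        (if x < e⁻¹ x then (if x < e x then X 4 else X 3) else 0)) := by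
  have hxx : e x = x ↔ e⁻¹ x = x := by rw [inv_eq_iff_eq, eq_comm]
  unfold insertion kind
  rw [mkDerivation_X]
  by_cases h1 : e x = x
  · have h2 := hxx.1 h1
    simp [h1, h2]
  · have h2 : e⁻¹ x ≠ x := fun h => h1 (hxx.2 h)
    by_cases h3 : x < e⁻¹ x <;> by_cases h4 : x < e x <;> simp only [h1, h3, h4, if_true, if_false]
    · simp [add_comm]
    all_goals simp

theorem sum_kindMonomial_decomposeFin_symm_succ {n : ℕ} (e : Perm (Fin n)) :
    ∑ j : Fin n, kindMonomial (n := n + 1) (decomposeFin.symm (j.succ, e)) =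
      insertion (kindMonomial e) := by
  have h0 : insertion (X 0 ^ cycStat n e) = 0 := by
    rw [Derivation.leibniz_pow]
    simp [insertion, mkDerivation_X]
  have hre : ∑ j : Fin n, (if e⁻¹ j < j then (if e⁻¹ j < e⁻¹ (e⁻¹ j) then X 5 else X 3) *
        ∏ x ∈ univ.erase (e⁻¹ j), (X (kind e x) : MvPolynomial (Fin 6) ℤ) else 0) =
      ∑ j : Fin n, (if j < e j then (if j < e⁻¹ j then X 5 else X 3) *
        ∏ x ∈ univ.erase j, X (kind e x) else 0) := by
    rw [← Equiv.sum_comp e]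
    simp
  simp only [kindMonomial, Fin.prod_univ_succ, cycStat_decomposeFin_symm_succ,
    kind_decomposeFin_symm_succ_zero, prod_kind_decomposeFin_symm_succ]
  rw [Derivation.leibniz, h0, smul_zero, add_zero, derivation_prod, smul_eq_mul,
    ← Finset.mul_sum, ← Finset.mul_sum, Finset.sum_add_distrib, Finset.sum_add_distrib, hre,
    ← Finset.sum_add_distrib, ← Finset.sum_add_distrib, Finset.mul_sum]
  congr 1
  refine Finset.sum_congr rfl fun x _ => ?_
  rw [insertion_X_kind]
  split_ifs <;> ring

theorem kindPoly_succ (n : ℕ) :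
    kindPoly (n + 1) = X 0 * X 1 * kindPoly n + insertion (kindPoly n) := by
  rw [kindPoly, ← Equiv.sum_comp decomposeFin.symm, Fintype.sum_prod_type, Fin.sum_univ_succ,
    Finset.sum_comm]
  simp only [sum_kindMonomial_decomposeFin_symm_succ, kindMonomial_decomposeFin_symm_zero]
  rw [← Finset.mul_sum, ← map_sum]
  rfl

/-- The polynomials in which double excedances and double drops play the same role. -/
def symmetricSubalgebra : Subalgebra ℤ (MvPolynomial (Fin 6) ℤ) :=
  Algebra.adjoin ℤ {X 0, X 1, X 2, X 3, X 4 + X 5}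

theorem X_mem_symmetricSubalgebra {i : Fin 6} (hi : i < 4) : X i ∈ symmetricSubalgebra := by
  apply Algebra.subset_adjoin
  fin_cases i <;> simp at hi ⊢

theorem X_four_add_X_five_mem_symmetricSubalgebra : X 4 + X 5 ∈ symmetricSubalgebra :=
  Algebra.subset_adjoin (by simp)

theorem insertion_mem_symmetricSubalgebra {p : MvPolynomial (Fin 6) ℤ}
    (hp : p ∈ symmetricSubalgebra) : insertion p ∈ symmetricSubalgebra := by
  have h2 := X_mem_symmetricSubalgebra (i := 2) (by decide)
  have h3 := X_mem_symmetricSubalgebra (i := 3) (by decide)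
  induction hp using Algebra.adjoin_induction with
  | mem x hx =>
    simp only [Set.mem_insert_iff, Set.mem_singleton_iff] at hx
    have h23 := mul_mem h2 h3
    have h24 := mul_mem h2 X_four_add_X_five_mem_symmetricSubalgebra
    rcases hx with rfl | rfl | rfl | rfl | rfl
    · simp [insertion, mkDerivation_X, zero_mem]
    · simpa [insertion, mkDerivation_X] using h23
    · simpa [insertion, mkDerivation_X] using h24
    · simp [insertion, mkDerivation_X, zero_mem]
    · simpa [insertion, mkDerivation_X] using add_mem h23 h23
  | algebraMap r => simp [zero_mem]
  | add x y _ _ hx hy => rw [map_add]; exact add_mem hx hy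
  | mul x y hx' hy' hx hy =>
    rw [Derivation.leibniz]
    exact add_mem (mul_mem hx' hy) (mul_mem hy' hx)

theorem kindPoly_mem_symmetricSubalgebra (n : ℕ) : kindPoly n ∈ symmetricSubalgebra := by
  induction n with
  | zero =>
    rw [kindPoly]
    refine sum_mem fun σ _ => mul_mem (pow_mem (X_mem_symmetricSubalgebra (by decide)) _) ?_
    simp [one_mem]
  | succ n ih =>
    rw [kindPoly_succ]
    exact add_mem (mul_mem (mul_mem (X_mem_symmetricSubalgebra (by decide))
      (X_mem_symmetricSubalgebra (by decide))) ih) (insertion_mem_symmetricSubalgebra ih)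

theorem aeval_kindPoly_eq (n : ℕ) (b v t u : MvPolynomial (Fin 2) ℤ) :
    aeval ![b, 0, v, 1, t, u] (kindPoly n) = aeval ![b, 0, v, 1, t + u, 0] (kindPoly n) := by
  have h : symmetricSubalgebra ≤ AlgHom.equalizer
      (aeval ![b, 0, v, 1, t, u]) (aeval ![b, 0, v, 1, t + u, 0]) := by
    refine Algebra.adjoin_le ?_
    intro x hx
    simp only [Set.mem_insert_iff, Set.mem_singleton_iff] at hx
    rcases hx with rfl | rfl | rfl | rfl | rfl <;> simp
  exact h (kindPoly_mem_symmetricSubalgebra n)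

end Recursion

section Statistics

open Equiv Equiv.Perm

theorem card_filter_Icc_one (n : ℕ) (P : ℕ → Prop) [DecidablePred P] :
    ((Icc 1 n).filter P).card = (univ.filter fun x : Fin n => P (x + 1)).card := by
  symm
  refine Finset.card_bij (fun x _ => (x : ℕ) + 1) ?_ ?_ ?_
  · intro x hx
    simp only [mem_filter, mem_univ, true_and, mem_Icc] at hx ⊢
    exact ⟨⟨by omega, x.isLt⟩, hx⟩
  · intro x _ y _ h
    exact Fin.ext (by omega)
  · intro b hb
    simp only [mem_filter, mem_Icc] at hb
    have hb' : b - 1 + 1 = b := by omega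
    exact ⟨⟨b - 1, by omega⟩, by simp [hb', hb.2], hb'⟩

theorem pext_add_one {n : ℕ} (σ : Perm (Fin n)) (x : Fin n) : pext n σ (x + 1) = σ x + 1 := by
  simp [pext]

theorem excStat_eq {n : ℕ} (σ : Perm (Fin n)) :
    excStat n σ = (univ.filter fun x => x < σ x).card := by
  rw [excStat, card_filter_Icc_one]
  simp only [pext_add_one, Fin.lt_def, Nat.add_lt_add_iff_right]

theorem cvalleyStat_eq {n : ℕ} (σ : Perm (Fin n)) :
    cvalleyStat n σ = (univ.filter fun x => x < σ⁻¹ x ∧ x < σ x).card := by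
  rw [cvalleyStat, card_filter_Icc_one]
  simp only [pext_add_one, Fin.lt_def, Nat.add_lt_add_iff_right]

theorem fixStat_eq_zero_iff {n : ℕ} (σ : Perm (Fin n)) : fixStat n σ = 0 ↔ ∀ x, σ x ≠ x := by
  rw [fixStat, card_filter_Icc_one]
  simp [pext_add_one, Fin.ext_iff, Finset.filter_eq_empty_iff]

theorem cddStat_eq_zero_iff {n : ℕ} (σ : Perm (Fin n)) :
    cddStat n σ = 0 ↔ ∀ x, ¬ (x < σ⁻¹ x ∧ σ x < x) := by
  rw [cddStat, card_filter_Icc_one, Finset.card_eq_zero, Finset.filter_eq_empty_iff]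
  simp only [pext_add_one, Fin.lt_def, Nat.add_lt_add_iff_right, mem_univ, true_imp_iff]

theorem two_mul_cvalleyStat_add_card {n : ℕ} {σ : Perm (Fin n)} (hf : ∀ x, σ x ≠ x)
    (hd : ∀ x, ¬ (x < σ⁻¹ x ∧ σ x < x)) :
    2 * cvalleyStat n σ + (univ.filter fun x => ¬ x < σ⁻¹ x ∧ x < σ x).card = n := by
  have h1 : (univ.filter fun x => ¬ x < σ x).card = cvalleyStat n σ := by
    rw [cvalleyStat_eq]
    refine Finset.card_bij (fun x _ => σ x) ?_ (fun x _ y _ h => σ.injective h) ?_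
    · intro x hx
      simp only [mem_filter, mem_univ, true_and, not_lt] at hx ⊢
      have hlt : σ x < x := lt_of_le_of_ne hx (hf x)
      have h := hd (σ x)
      rw [show σ⁻¹ (σ x) = x from σ.symm_apply_apply x] at h ⊢
      simp only [hlt, true_and, not_lt] at h ⊢
      exact lt_of_le_of_ne h (hf _).symm
    · intro y hy
      simp only [mem_filter, mem_univ, true_and] at hy
      exact ⟨σ⁻¹ y, by simpa using hy.1.le, by simp⟩
  have h2 := Finset.card_filter_add_card_filter_not (s := (univ : Finset (Fin n)))
    (fun x => x < σ x)
  have h3 := Finset.card_filter_add_card_filter_not (s := univ.filter fun x : Fin n => x < σ x)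
    (fun x => x < σ⁻¹ x)
  rw [Finset.filter_filter, Finset.filter_filter] at h3
  simp only [and_comm (a := _ < σ _)] at h3
  rw [← cvalleyStat_eq] at h3
  rw [Finset.card_univ, Fintype.card_fin] at h2
  omega

open MvPolynomial

theorem prod_ite_const_one {ι R : Type*} [CommMonoid R] (s : Finset ι) (P : ι → Prop)
    [DecidablePred P] (a : R) : ∏ x ∈ s, (if P x then a else 1) = a ^ (s.filter P).card := by
  rw [← Finset.prod_filter, Finset.prod_const]

theorem aeval_kindMonomial_of_apply_eq {n : ℕ} {σ : Perm (Fin n)} {x : Fin n} (hx : σ x = x)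
    (b c d e f : MvPolynomial (Fin 2) ℤ) :
    aeval ![b, 0, c, d, e, f] (kindMonomial σ) = 0 := by
  rw [kindMonomial, map_mul, map_prod, Finset.prod_eq_zero (mem_univ x), mul_zero]
  simp [kind, hx]

theorem aeval_kindMonomial_exc {n : ℕ} (σ : Perm (Fin n)) (b t : MvPolynomial (Fin 2) ℤ) :
    aeval ![b, 0, t, 1, t, 1] (kindMonomial σ) =
      if fixStat n σ = 0 then b ^ cycStat n σ * t ^ excStat n σ else 0 := by
  split_ifs with h
  · rw [fixStat_eq_zero_iff] at h
    rw [kindMonomial, map_mul, map_prod, excStat_eq, ← prod_ite_const_one]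
    congr 1
    · simp
    · refine Finset.prod_congr rfl fun x _ => ?_
      rw [kind, if_neg (h x)]
      split_ifs <;> simp
  · rw [fixStat_eq_zero_iff] at h
    push Not at h
    obtain ⟨x, hx⟩ := h
    exact aeval_kindMonomial_of_apply_eq hx ..

theorem aeval_kindMonomial_cvalley {n : ℕ} (σ : Perm (Fin n)) (b t s : MvPolynomial (Fin 2) ℤ) :
    aeval ![b, 0, t, 1, s, 0] (kindMonomial σ) =
      if fixStat n σ = 0 ∧ cddStat n σ = 0 then
        b ^ cycStat n σ * t ^ cvalleyStat n σ * s ^ (n - 2 * cvalleyStat n σ) else 0 := by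
  by_cases hf : fixStat n σ = 0
  · have hf' := (fixStat_eq_zero_iff σ).1 hf
    by_cases hd : cddStat n σ = 0
    · have hd' := (cddStat_eq_zero_iff σ).1 hd
      have hn := two_mul_cvalleyStat_add_card hf' hd'
      rw [if_pos ⟨hf, hd⟩, ← Nat.eq_sub_of_add_eq' hn, cvalleyStat_eq, ← prod_ite_const_one,
        ← prod_ite_const_one, mul_assoc, ← Finset.prod_mul_distrib, kindMonomial, map_mul, map_prod]
      congr 1
      · simp
      · refine Finset.prod_congr rfl fun x _ => ?_
        have hx : x < σ⁻¹ x → x < σ x := fun h =>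
          lt_of_le_of_ne (not_lt.1 fun h' => hd' x ⟨h, h'⟩) (hf' x).symm
        rw [kind, if_neg (hf' x)]
        by_cases h1 : x < σ⁻¹ x
        · simp only [h1, hx h1, if_true, not_true, false_and, if_false, and_self]
          simp
        · by_cases h2 : x < σ x <;>
            simp only [h1, h2, if_true, if_false, not_false_iff, and_self, and_false, false_and] <;>
            simp
    · rw [if_neg (fun h => hd h.2)]
      rw [cddStat_eq_zero_iff] at hd
      push Not at hd
      obtain ⟨x, hx, hx'⟩ := hd
      rw [kindMonomial, map_mul, map_prod, Finset.prod_eq_zero (mem_univ x), mul_zero]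
      rw [kind, if_neg hx'.ne, if_pos hx, if_neg hx'.not_gt]
      simp
  · rw [if_neg (fun h => hf h.1)]
    rw [fixStat_eq_zero_iff] at hf
    push Not at hf
    obtain ⟨x, hx⟩ := hf
    exact aeval_kindMonomial_of_apply_eq hx ..

theorem sum_cPoly_mul (n : ℕ) (t s : MvPolynomial (Fin 2) ℤ) :
    ∑ k ∈ Finset.range (n / 2 + 1), cPoly n k * t ^ k * s ^ (n - 2 * k) =
      ∑ σ : Perm (Fin n), if fixStat n σ = 0 ∧ cddStat n σ = 0 then
        X 0 ^ cycStat n σ * t ^ cvalleyStat n σ * s ^ (n - 2 * cvalleyStat n σ) else 0 := by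
  simp only [cPoly, Finset.sum_filter, Finset.sum_mul]
  rw [Finset.sum_comm]
  refine Finset.sum_congr rfl fun σ _ => ?_
  by_cases h : fixStat n σ = 0 ∧ cddStat n σ = 0
  · have hn := two_mul_cvalleyStat_add_card ((fixStat_eq_zero_iff σ).1 h.1)
      ((cddStat_eq_zero_iff σ).1 h.2)
    rw [Finset.sum_eq_single_of_mem (cvalleyStat n σ) (by rw [Finset.mem_range]; omega)]
    · simp [h]
    · intro k _ hk
      simp [hk.symm]
  · rw [if_neg h]
    refine Finset.sum_eq_zero fun k _ => ?_
    rw [if_neg (fun h' => h ⟨h'.1, h'.2.2⟩), zero_mul, zero_mul]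

end Statistics

open MvPolynomial in
theorem statement11 (n : ℕ) (hn : 1 ≤ n) :
    (∑ σ ∈ Finset.univ.filter
        (fun σ : Equiv.Perm (Fin n) => fixStat n σ = 0),
      (X 0 : MvPolynomial (Fin 2) ℤ) ^ cycStat n σ * X 1 ^ excStat n σ) =
      ∑ k ∈ Finset.range (n / 2 + 1),
        cPoly n k * X 1 ^ k * (1 + X 1) ^ (n - 2 * k) := by
  have h := aeval_kindPoly_eq n (X 0) (X 1) (X 1) 1
  simp only [kindPoly, map_sum, aeval_kindMonomial_exc, aeval_kindMonomial_cvalley] at h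
  rw [Finset.sum_filter, sum_cPoly_mul, h, add_comm (X 1)]

end SZpaper
end
end
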